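/- arXiv:1706.07373 — 6 statements merged into one kernel-verified Lean document; each statement's English description precedes it below -/
import Mathlib

section
/- Let A be a CM-order and a ∈ A. If a is regular (multiplication by a is injective on A) and Tr_{A/ℤ}(a·ā) ≤ rank_ℤ(A), then a·ā = 1 and hence a is a root of unity in A. -/
open TensorProduct Polynomial

theorem aux_root {A : Type*} [CommRing A] [Module.Free ℤ A] [Module.Finite ℤ A] (b : A) (z : ℂ)
    (hz : ((Algebra.lmul ℤ A b).baseChange ℂ).charpoly.IsRoot z) : ∃ ψ : A →+* ℂ, ψ b = z := by
  have h1 := (Module.End.hasEigenvalue_iff_isRoot_charpoly _ _).2 hz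
  obtain ⟨v, hv⟩ := h1.exists_hasEigenvector
  have h2 : ((1 : ℂ) ⊗ₜ[ℤ] b - algebraMap ℂ (ℂ ⊗[ℤ] A) z) * v = 0 := by
    have := hv.apply_eq_smul
    have h3 : ((Algebra.lmul ℤ A b).baseChange ℂ) = Algebra.lmul ℂ (ℂ ⊗[ℤ] A) (1 ⊗ₜ b) :=
      Algebra.baseChange_lmul b
    rw [h3] at this
    rw [sub_mul, sub_eq_zero, ← Algebra.smul_def]
    exact this
  have h3 : ¬ IsUnit ((1 : ℂ) ⊗ₜ[ℤ] b - algebraMap ℂ (ℂ ⊗[ℤ] A) z) := fun hu =>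
    hv.2 (hu.mul_right_eq_zero.1 h2)
  obtain ⟨M, hM, hm⟩ := exists_max_ideal_of_mem_nonunits h3
  have hb := IsAlgClosed.algebraMap_bijective_of_isIntegral (k := ℂ) (K := (ℂ ⊗[ℤ] A) ⧸ M)
  let e := RingEquiv.ofBijective _ hb
  refine ⟨(e.symm.toRingHom.comp (Ideal.Quotient.mk M)).comp
    (Algebra.TensorProduct.includeRight : A →ₐ[ℤ] ℂ ⊗[ℤ] A).toRingHom, ?_⟩
  change e.symm (Ideal.Quotient.mk M ((1 : ℂ) ⊗ₜ[ℤ] b)) = z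
  rw [RingEquiv.symm_apply_eq, Ideal.Quotient.eq.2 hm]
  rfl

theorem aux_root' {A : Type*} [CommRing A] [Module.Free ℤ A] [Module.Finite ℤ A] (b : A)
    (ψ : A →+* ℂ) : ((Algebra.lmul ℤ A b).baseChange ℂ).charpoly.IsRoot (ψ b) := by
  have h := LinearMap.aeval_self_charpoly (Algebra.lmul ℤ A b)
  have h2 : aeval b (Algebra.lmul ℤ A b).charpoly = 0 := by
    rw [aeval_algHom_apply] at h
    have := congrArg (fun f => f 1) h
    simpa using this
  rw [LinearMap.charpoly_baseChange, IsRoot, eval_map]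
  have h3 := congrArg ψ h2
  rw [map_zero, aeval_def, hom_eval₂] at h3
  have h4 : ψ.comp (algebraMap ℤ A) = algebraMap ℤ ℂ := Subsingleton.elim _ _
  rw [h4] at h3
  exact h3

theorem aux_zero {A : Type*} [CommRing A] [IsReduced A] [Module.Free ℤ A] [Module.Finite ℤ A]
    (c : A) (h : ∀ ψ : A →+* ℂ, ψ c = 0) : c = 0 := by
  apply IsNilpotent.eq_zero
  have h0 : ∀ z ∈ ((Algebra.lmul ℤ A c).baseChange ℂ).charpoly.roots, z = 0 := fun z hz => by
    obtain ⟨ψ, rfl⟩ := aux_root c z (isRoot_of_mem_roots hz)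
    exact h ψ
  have h1 := (IsAlgClosed.splits ((Algebra.lmul ℤ A c).baseChange ℂ).charpoly).eq_prod_roots_of_monic
    (LinearMap.charpoly_monic _)
  rw [Multiset.eq_replicate_card.2 h0] at h1
  rw [LinearMap.charpoly_baseChange] at h1
  set k := Multiset.card ((Algebra.lmul ℤ A c).charpoly.map (algebraMap ℤ ℂ)).roots
  have h2 : (Algebra.lmul ℤ A c).charpoly = X ^ k := by
    apply Polynomial.map_injective (algebraMap ℤ ℂ) (algebraMap ℤ ℂ).injective_int
    simpa using h1
  have h := LinearMap.aeval_self_charpoly (Algebra.lmul ℤ A c)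
  rw [h2, aeval_algHom_apply] at h
  have := congrArg (fun f => f 1) h
  exact ⟨k, by simpa using this⟩

theorem aux_amgm (s : Multiset ℝ) (hs : ∀ x ∈ s, 0 < x) :
    0 < s.prod ∧ Multiset.card s + Real.log s.prod ≤ s.sum := by
  induction s using Multiset.induction with
  | empty => simp
  | cons x t ih =>
    have hx := hs x (by simp)
    obtain ⟨h1, h2⟩ := ih fun y hy => hs y (by simp [hy])
    simp only [Multiset.prod_cons, Multiset.card_cons, Multiset.sum_cons]
    refine ⟨by positivity, ?_⟩
    rw [Real.log_mul hx.ne' h1.ne']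
    have := Real.log_le_sub_one_of_pos hx
    push_cast
    linarith

theorem aux_amgm' (s : Multiset ℝ) (hs : ∀ x ∈ s, 0 < x) (hp : 1 ≤ s.prod)
    (hsum : s.sum ≤ Multiset.card s) : ∀ x ∈ s, x = 1 := by
  intro x hx
  obtain ⟨t, rfl⟩ := Multiset.exists_cons_of_mem hx
  obtain ⟨h1, h2⟩ := aux_amgm t fun y hy => hs y (by simp [hy])
  have hx := hs x (by simp)
  simp only [Multiset.prod_cons, Multiset.card_cons, Multiset.sum_cons] at *
  have h3 := Real.log_nonneg hp
  rw [Real.log_mul hx.ne' h1.ne'] at h3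
  by_contra hne
  have := Real.log_lt_sub_one_of_pos hx hne
  push_cast at *
  linarith

/-- In a CM-order `A`, if `a` is regular and `Tr(a · σ a) ≤ rank_ℤ A`, then
`a · σ a = 1` and `a` is a root of unity. -/
theorem stmt7 (A : Type*) [CommRing A] [IsReduced A]
    [Module.Free ℤ A] [Module.Finite ℤ A]
    (σ : A ≃+* A)
    (hσ : ∀ (ψ : A →+* ℂ) (x : A), ψ (σ x) = starRingEnd ℂ (ψ x))
    (a : A)
    (hreg : Function.Injective fun x : A => a * x)
    (htr : Algebra.trace ℤ A (a * σ a) ≤ (Module.finrank ℤ A : ℤ)) :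
    a * σ a = 1 ∧ ∃ m : ℕ, 0 < m ∧ a ^ m = 1 := by
  have hψ : ∀ ψ : A →+* ℂ, ψ (a * σ a) = ((‖ψ a‖ ^ 2 : ℝ) : ℂ) := fun ψ => by
    rw [map_mul, hσ, Complex.mul_conj, Complex.normSq_eq_norm_sq]
  have hreg2 : Function.Injective (Algebra.lmul ℤ A (a * σ a)) := by
    have h : ∀ x, a * x = 0 → x = 0 := fun x hx => hreg (by simpa using hx)
    rw [injective_iff_map_eq_zero]
    intro x hx
    have hx' : a * (σ a * x) = 0 := by rw [← mul_assoc]; exact hx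
    have h1 := congrArg σ.symm (h _ hx')
    rw [map_mul, σ.symm_apply_apply, map_zero] at h1
    simpa using h _ h1
  have hone : a * σ a = 1 := by
    set b := a * σ a with hb
    set F := (Algebra.lmul ℤ A b).baseChange ℂ with hF
    have hsp := IsAlgClosed.splits F.charpoly
    have htrF := Module.End.trace_eq_sum_roots_charpoly_of_splits hsp
    have hdetF := Module.End.det_eq_prod_roots_charpoly_of_splits hsp
    have hcard : Multiset.card F.charpoly.roots = Module.finrank ℤ A := by
      rw [← hsp.natDegree_eq_card_roots, LinearMap.charpoly_natDegree]
      exact Module.finrank_baseChange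
    have hd0 : LinearMap.det (Algebra.lmul ℤ A b) ≠ 0 := by
      intro h0
      exact LinearMap.det_eq_zero_iff_ker_ne_bot.1 h0 (LinearMap.ker_eq_bot.2 hreg2)
    rw [hF, LinearMap.trace_baseChange, ← hF] at htrF
    rw [hF, LinearMap.det_baseChange, ← hF] at hdetF
    have hroot : ∀ z ∈ F.charpoly.roots, ∃ ψ : A →+* ℂ, ψ b = z := fun z hz =>
      aux_root b z (isRoot_of_mem_roots hz)
    have hre : ∀ z ∈ F.charpoly.roots, ((‖z‖ : ℝ) : ℂ) = z := fun z hz => by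
      obtain ⟨ψ, rfl⟩ := hroot z hz
      rw [hψ]
      simp
    set s : Multiset ℝ := F.charpoly.roots.map (fun z => ‖z‖) with hs
    have hsmap : s.map (⇑Complex.ofRealHom) = F.charpoly.roots := by
      rw [hs, Multiset.map_map]
      conv_rhs => rw [← Multiset.map_id F.charpoly.roots]
      exact Multiset.map_congr rfl hre
    have hsum : s.sum = (Algebra.trace ℤ A b : ℤ) := by
      have : ((s.sum : ℝ) : ℂ) = ((Algebra.trace ℤ A b : ℤ) : ℂ) := by
        rw [← Complex.ofRealHom_eq_coe, map_multiset_sum]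
        exact (congrArg Multiset.sum hsmap).trans htrF.symm
      exact_mod_cast this
    have hprod : s.prod = (LinearMap.det (Algebra.lmul ℤ A b) : ℤ) := by
      have : ((s.prod : ℝ) : ℂ) = ((LinearMap.det (Algebra.lmul ℤ A b) : ℤ) : ℂ) := by
        rw [← Complex.ofRealHom_eq_coe, map_multiset_prod]
        exact (congrArg Multiset.prod hsmap).trans hdetF.symm
      exact_mod_cast this
    have hs0 : ∀ x ∈ s, 0 ≤ x := fun x hx => by
      obtain ⟨z, _, rfl⟩ := Multiset.mem_map.1 hx
      exact norm_nonneg _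
    have hp0 : s.prod ≠ 0 := by rw [hprod]; exact_mod_cast hd0
    have hpos : ∀ x ∈ s, 0 < x := fun x hx => lt_of_le_of_ne (hs0 x hx) fun h => by
      subst h
      exact hp0 (Multiset.prod_eq_zero hx)
    have hp1 : 1 ≤ s.prod := by
      have := (aux_amgm s hpos).1
      rw [hprod] at this ⊢
      exact_mod_cast this
    have hall := aux_amgm' s hpos hp1 (by
      rw [hsum, hs, Multiset.card_map, hcard]; exact_mod_cast htr)
    rw [← sub_eq_zero]
    refine aux_zero _ fun ψ => ?_
    have hm : ψ b ∈ F.charpoly.roots :=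
      (mem_roots (LinearMap.charpoly_monic _).ne_zero).2 (aux_root' b ψ)
    have := hall _ (Multiset.mem_map_of_mem (fun z => ‖z‖) hm)
    rw [map_sub, map_one, ← hre _ hm, this]
    simp
  refine ⟨hone, ?_⟩
  have hnorm : ∀ ψ : A →+* ℂ, ‖ψ a‖ = 1 := fun ψ => by
    have := hψ ψ
    rw [hone, map_one] at this
    have h2 : ‖ψ a‖ ^ 2 = 1 := by exact_mod_cast this.symm
    nlinarith [norm_nonneg (ψ a)]
  set F := (Algebra.lmul ℤ A a).baseChange ℂ with hF
  have hFm : F.charpoly.Monic := LinearMap.charpoly_monic _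
  have hFc : F.charpoly = (Algebra.lmul ℤ A a).charpoly.map (Int.castRingHom ℂ) :=
    LinearMap.charpoly_baseChange _ _
  have hmah : ((Algebra.lmul ℤ A a).charpoly.map (Int.castRingHom ℂ)).mahlerMeasure = 1 := by
    rw [← hFc, mahlerMeasure_eq_leadingCoeff_mul_prod_roots, hFm.leadingCoeff, norm_one, one_mul]
    apply Multiset.prod_eq_one
    intro x hx
    obtain ⟨z, hz, rfl⟩ := Multiset.mem_map.1 hx
    obtain ⟨ψ, rfl⟩ := aux_root a z (isRoot_of_mem_roots hz)
    simp [hnorm]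
  have hru : ∀ z : ℂ, ∃ n, 0 < n ∧ (z ∈ F.charpoly.roots → z ^ n = 1) := fun z => by
    by_cases hz : z ∈ F.charpoly.roots
    · obtain ⟨ψ, hψz⟩ := aux_root a z (isRoot_of_mem_roots hz)
      obtain ⟨n, hn, h⟩ := pow_eq_one_of_mahlerMeasure_eq_one hmah (z := z)
        (by rw [← norm_ne_zero_iff, ← hψz, hnorm]; simp) (by rw [hFc] at hz; exact hz)
      exact ⟨n, hn, fun _ => h⟩
    · exact ⟨1, one_pos, fun h => absurd h hz⟩
  choose n hn hz using hru
  refine ⟨∏ z ∈ F.charpoly.roots.toFinset, n z, Finset.prod_pos fun z _ => hn z, ?_⟩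
  rw [← sub_eq_zero]
  refine aux_zero _ fun ψ => ?_
  have hm : ψ a ∈ F.charpoly.roots := (mem_roots hFm.ne_zero).2 (aux_root' a ψ)
  obtain ⟨k, hk⟩ := Finset.dvd_prod_of_mem n (Multiset.mem_toFinset.2 hm)
  rw [map_sub, map_pow, map_one, hk, pow_mul, hz _ hm, one_pow, sub_self]
end

section
/- For x ≥ 4 and 2 ≤ y ≤ x, the number ψ(x,y) of positive integers m ≤ x all of whose prime divisors are ≤ y satisfies ψ(x,y) > x^{1 − log log x / log y}. -/
open Real
open scoped Chebyshev ArithmeticFunction.vonMangoldt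

noncomputable def smA (x y : ℝ) : Finset ℕ := by
  classical
  exact (Finset.Icc 1 ⌊x⌋₊).filter (fun m => ∀ p : ℕ, p.Prime → p ∣ m → (p : ℝ) ≤ y)

lemma mem_smA {x y : ℝ} (hx : 0 ≤ x) {m : ℕ} :
    m ∈ smA x y ↔ 0 < m ∧ (m : ℝ) ≤ x ∧ ∀ p : ℕ, p.Prime → p ∣ m → (p : ℝ) ≤ y := by
  unfold smA
  simp only [Finset.mem_filter, Finset.mem_Icc, Nat.le_floor_iff hx]
  constructor
  · rintro ⟨⟨a, b⟩, c⟩; exact ⟨a, b, c⟩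
  · rintro ⟨a, b, c⟩; exact ⟨⟨a, b⟩, c⟩

lemma smA_card {x y : ℝ} (hx : 0 ≤ x) :
    Nat.card {m : ℕ // 0 < m ∧ (m : ℝ) ≤ x ∧ ∀ p : ℕ, p.Prime → p ∣ m → (p : ℝ) ≤ y}
      = (smA x y).card := by
  have h : (smA x y).card = Nat.card {m : ℕ // m ∈ smA x y} := by simp
  rw [h]
  apply Nat.card_congr
  apply Equiv.subtypeEquivRight
  intro m
  rw [mem_smA hx]

lemma smooth_of_le {y : ℝ} {k : ℕ} (hk : 0 < k) (h : (k : ℝ) ≤ y) :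
    ∀ p : ℕ, p.Prime → p ∣ k → (p : ℝ) ≤ y := by
  intro p _ hd
  have : p ≤ k := Nat.le_of_dvd hk hd
  exact le_trans (by exact_mod_cast this) h

lemma key {x y : ℝ} (hx : 1 ≤ x) (K : Finset ℕ) (z : ℕ → ℝ)
    (hK : ∀ k ∈ K, 0 < k ∧ ∀ p : ℕ, p.Prime → p ∣ k → (p : ℝ) ≤ y)
    (hz : ∀ k ∈ K, 0 ≤ z k ∧ z k ≤ y ∧ k * z k ≤ x) :
    ∑ k ∈ K, ψ (z k) ≤ (smA x y).card * log x := by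
  have hx0 : 0 ≤ x := by linarith
  have h1 : ∑ m ∈ smA x y, log m ≤ (smA x y).card * log x := by
    rw [← nsmul_eq_mul]
    apply Finset.sum_le_card_nsmul
    intro m hm
    rw [mem_smA hx0] at hm
    exact log_le_log (by exact_mod_cast hm.1) hm.2.1
  refine le_trans ?_ h1
  have h2 : ∑ m ∈ smA x y, log m = ∑ s ∈ (smA x y).sigma (fun m => m.divisors), Λ s.2 := by
    rw [Finset.sum_sigma]
    exact Finset.sum_congr rfl fun m _ => (ArithmeticFunction.vonMangoldt_sum).symm
  have h3 : ∑ k ∈ K, ψ (z k) = ∑ s ∈ K.sigma (fun k => Finset.Ioc 0 ⌊z k⌋₊), Λ s.2 := by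
    rw [Finset.sum_sigma]; rfl
  rw [h2, h3]
  have hinj : Set.InjOn (fun s : (_ : ℕ) × ℕ => (⟨s.1 * s.2, s.2⟩ : (_ : ℕ) × ℕ))
      (K.sigma (fun k => Finset.Ioc 0 ⌊z k⌋₊) : Set ((_ : ℕ) × ℕ)) := by
    rintro ⟨a, b⟩ hab ⟨c, d⟩ hcd h
    simp only [Finset.coe_sigma, Set.mem_sigma_iff, Finset.mem_coe, Finset.mem_Ioc] at hab hcd
    simp only [Sigma.mk.injEq, heq_eq_eq] at h
    obtain ⟨h, rfl⟩ := h
    have := Nat.eq_of_mul_eq_mul_right hab.2.1 h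
    subst this; rfl
  calc ∑ s ∈ K.sigma (fun k => Finset.Ioc 0 ⌊z k⌋₊), Λ s.2
      = ∑ s ∈ (K.sigma (fun k => Finset.Ioc 0 ⌊z k⌋₊)).image
          (fun s : (_ : ℕ) × ℕ => (⟨s.1 * s.2, s.2⟩ : (_ : ℕ) × ℕ)), Λ s.2 := by
        rw [Finset.sum_image hinj]
    _ ≤ _ := by
        apply Finset.sum_le_sum_of_subset_of_nonneg
        · intro s hs
          rw [Finset.mem_image] at hs
          obtain ⟨⟨k, d⟩, hkd, rfl⟩ := hs
          simp only [Finset.mem_sigma, Finset.mem_Ioc] at hkd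
          obtain ⟨hk, hd0, hd⟩ := hkd
          obtain ⟨hk0, hks⟩ := hK k hk
          obtain ⟨z0, zy, zx⟩ := hz k hk
          have hdz : (d : ℝ) ≤ z k := (Nat.le_floor_iff z0).1 hd
          simp only [Finset.mem_sigma, Nat.mem_divisors]
          refine ⟨(mem_smA hx0).2 ⟨Nat.mul_pos hk0 hd0, ?_, ?_⟩, ⟨Dvd.intro_left k rfl, (Nat.mul_pos hk0 hd0).ne'⟩⟩
          · push_cast
            exact le_trans (mul_le_mul_of_nonneg_left hdz (by positivity)) zx
          · intro p hp hpd
            rcases (Nat.Prime.dvd_mul hp).1 hpd with h | h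
            · exact hks p hp h
            · exact smooth_of_le hd0 (hdz.trans zy) p hp h
        · intro s _ _
          exact ArithmeticFunction.vonMangoldt_nonneg

lemma card_ge_floor {x y : ℝ} (hy : 0 ≤ y) (hyx : y ≤ x) : y - 1 < (smA x y).card := by
  have h : Finset.Icc 1 ⌊y⌋₊ ⊆ smA x y := by
    intro m hm
    rw [Finset.mem_Icc, Nat.le_floor_iff hy] at hm
    exact (mem_smA (hy.trans hyx)).2 ⟨hm.1, hm.2.trans hyx, smooth_of_le hm.1 hm.2⟩
  have h2 := Finset.card_le_card h
  rw [Nat.card_Icc, Nat.add_sub_cancel] at h2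
  have h3 := Nat.sub_one_lt_floor y
  have h4 : ((⌊y⌋₊ : ℕ) : ℝ) ≤ (smA x y).card := by exact_mod_cast h2
  linarith

lemma psi_half {z : ℝ} (hz : 5 ≤ z) : z / 2 ≤ ψ z := by
  have l2 := log_two_gt_d9
  have hb : ∀ (n : ℕ) (c : ℕ), (n : ℝ) ≤ z → (2:ℝ) ^ c ≤ (Nat.lcmUpto n : ℝ) ^ 2 → (c:ℝ) * log 2 / 2 ≤ ψ z := by
    intro n c hn h
    have := calc (c:ℝ) * log 2 = log ((2:ℝ)^c) := by rw [log_pow]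
      _ ≤ log ((Nat.lcmUpto n : ℝ)^2) := log_le_log (by positivity) h
      _ = 2 * ψ n := by rw [log_pow, Chebyshev.psi_eq_log_lcmUpto n]; norm_num
      _ ≤ 2 * ψ z := by linarith [Chebyshev.psi_mono hn]
    linarith
  rcases lt_or_ge z 7 with h | h
  · have := hb 5 11 (by norm_num; linarith) (by
      have : Nat.lcmUpto 5 = 60 := by decide
      rw [this]; norm_num)
    norm_num at this; linarith
  rcases lt_or_ge z 11 with h' | h'
  · have := hb 7 17 (by norm_num; linarith) (by
      have : Nat.lcmUpto 7 = 420 := by decide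
      rw [this]; norm_num)
    norm_num at this; linarith
  rcases lt_or_ge z 20 with h'' | h''
  · have := hb 11 29 (by norm_num; linarith) (by
      have : Nat.lcmUpto 11 = 27720 := by decide +kernel
      rw [this]; norm_num)
    norm_num at this; linarith
  · have := Chebyshev.psi_ge' (x := z) (by linarith)
    have h1 : log ((z + 2) / 22) ≤ (z + 2) / 22 - 1 := log_le_sub_one_of_pos (by positivity)
    rw [log_div (by linarith) (by norm_num)] at h1
    have h2 : log 22 ≤ 4.5 * log 2 := by
      have : 2 * log 22 ≤ 9 * log 2 := by
        have := log_le_log (by norm_num) (show (22:ℝ)^2 ≤ 2^9 by norm_num)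
        rw [log_pow, log_pow] at this; simpa using this
      linarith
    have l2' := log_two_lt_d9
    nlinarith

lemma exp_form {x y : ℝ} (hx : 1 < x) :
    x ^ (1 - log (log x) / log y) = exp (log x - log x * log (log x) / log y) := by
  rw [rpow_def_of_pos (by linarith)]
  congr 1; ring

/-- trivial range -/
lemma expo_le {l L y : ℝ} (hl : 0 < l) (hL : 0 < L) (hy : 0 < y) (hLy : L = log y) :
    l - l * log l / L ≤ y / exp 1 / L := by
  have h1 : log (y / l / exp 1) ≤ y / l / exp 1 - 1 := log_le_sub_one_of_pos (by positivity)
  rw [log_div (by positivity) (by positivity), log_div (by positivity) (by positivity), log_exp,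
    ← hLy] at h1
  have h2 : L - log l ≤ y / l / exp 1 := by linarith
  have h3 : l * (L - log l) ≤ y / exp 1 := by
    calc l * (L - log l) ≤ l * (y / l / exp 1) := mul_le_mul_of_nonneg_left h2 hl.le
      _ = y / exp 1 := by field_simp
  rw [le_div_iff₀ hL]
  calc (l - l * log l / L) * L = l * (L - log l) := by field_simp
    _ ≤ _ := h3

lemma log3_gt : (1.09 : ℝ) < log 3 := by
  have h := log_two_gt_d9
  have : 11 * log 2 ≤ 7 * log 3 := by
    have := log_le_log (by norm_num) (show (2:ℝ)^11 ≤ 3^7 by norm_num)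
    rw [log_pow, log_pow] at this; simpa using this
  have : 19 * log 2 ≤ 12 * log 3 := by
    have := log_le_log (by norm_num) (show (2:ℝ)^19 ≤ 3^12 by norm_num)
    rw [log_pow, log_pow] at this; simpa using this
  linarith

lemma small_case {x y : ℝ} (hx : 4 ≤ x) (hy : 2 ≤ y) (hy2 : log y < 2) :
    exp (log x - log x * log (log x) / log y) < (smA x y).card := by
  have hL : 0 < log y := log_pos (by linarith)
  have hl : 0 < log x := log_pos (by linarith)
  have h := expo_le hl hL (by linarith) rfl (y := y)
  have e1 := exp_one_gt_d9
  have e1' := exp_one_lt_d9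
  have g2 := log_two_gt_d9
  have g3 := log3_gt
  have hx0 : 0 ≤ x := by linarith
  have one_mem : 1 ∈ smA x y := (mem_smA hx0).2 ⟨by norm_num, by norm_num; linarith, smooth_of_le (by norm_num) (by norm_num; linarith)⟩
  have two_mem : 2 ∈ smA x y := (mem_smA hx0).2 ⟨by norm_num, by norm_num; linarith, smooth_of_le (by norm_num) (by norm_num; linarith)⟩
  have four_mem : 4 ∈ smA x y := by
    refine (mem_smA hx0).2 ⟨by norm_num, by norm_num; linarith, ?_⟩
    intro p hp hd
    have : p ∣ 2 := hp.dvd_of_dvd_pow (show p ∣ 2 ^ 2 from hd)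
    exact smooth_of_le (by norm_num) (by norm_num; linarith) p hp this
  rcases lt_or_ge y 3 with h3 | h3
  · have hc : 3 ≤ (smA x y).card := by
      have : ({1, 2, 4} : Finset ℕ) ⊆ smA x y := by
        intro m hm
        simp only [Finset.mem_insert, Finset.mem_singleton] at hm
        rcases hm with rfl | rfl | rfl <;> assumption
      exact Finset.card_le_card this
    have hc' : (3:ℝ) ≤ (smA x y).card := by exact_mod_cast hc
    refine lt_of_lt_of_le ?_ hc'
    rw [← lt_log_iff_exp_lt (by norm_num)]
    refine lt_of_le_of_lt h ?_
    rw [div_lt_iff₀ hL, div_lt_iff₀ (by positivity)]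
    -- y < log 3 * L * e
    have hLl : log 2 + (y - 2) * 0.39 ≤ log y := by
      have h5 : log 2 + (y-2) * (log 3 - log 2) ≤ log y := by
        have := strictConcaveOn_log_Ioi.concaveOn.2 (show (2:ℝ) ∈ Set.Ioi 0 by simp) (show (3:ℝ) ∈ Set.Ioi 0 by simp)
          (show 0 ≤ 3 - y by linarith) (show 0 ≤ y - 2 by linarith) (by ring)
        simp only [smul_eq_mul] at this
        have e : (3 - y) * 2 + (y - 2) * 3 = y := by ring
        rw [e] at this; linarith
      have := log_two_lt_d9
      nlinarith
    have h6 : 2.96 * log y ≤ log 3 * log y * exp 1 := by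
      have : 2.96 ≤ log 3 * exp 1 := by nlinarith
      nlinarith
    nlinarith
  · have three_mem : 3 ∈ smA x y := (mem_smA hx0).2 ⟨by norm_num, by norm_num; linarith, smooth_of_le (by norm_num) (by norm_num; linarith)⟩
    have hc : 4 ≤ (smA x y).card := by
      have : ({1, 2, 3, 4} : Finset ℕ) ⊆ smA x y := by
        intro m hm
        simp only [Finset.mem_insert, Finset.mem_singleton] at hm
        rcases hm with rfl | rfl | rfl | rfl <;> assumption
      exact Finset.card_le_card this
    have hc' : (4:ℝ) ≤ (smA x y).card := by exact_mod_cast hc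
    refine lt_of_lt_of_le ?_ hc'
    rw [← lt_log_iff_exp_lt (by norm_num)]
    refine lt_of_le_of_lt h ?_
    rw [div_lt_iff₀ hL]
    have l4 : log 4 = 2 * log 2 := by
      rw [show (4:ℝ) = 2 ^ 2 by norm_num, log_pow]; norm_num
    rw [l4]
    -- y = exp L ; y/e = exp (L-1), convex
    have hLl : log 3 ≤ log y := log_le_log (by norm_num) h3
    have hy' : y / exp 1 = exp (log y - 1) := by rw [exp_sub, exp_log (by linarith)]
    rw [hy']
    set L := log y
    have hcv := convexOn_exp.2 (Set.mem_univ (0:ℝ)) (Set.mem_univ (1:ℝ))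
      (show 0 ≤ 2 - L by linarith) (show 0 ≤ L - 1 by linarith) (by ring)
    simp only [smul_eq_mul] at hcv
    have e : (2 - L) * 0 + (L - 1) * 1 = L - 1 := by ring
    rw [e, exp_zero] at hcv
    nlinarith

lemma via_floor {x y E : ℝ} (hy : 7 ≤ y) (hyx : y ≤ x) (hE : E < log y + log (6/7)) :
    exp E < (smA x y).card := by
  have h1 := card_ge_floor (by linarith) hyx
  have h2 : exp E < y * (6/7) := by
    rw [← lt_log_iff_exp_lt (by linarith), log_mul (by linarith) (by norm_num)]; exact hE
  linarith

lemma log67 : -0.158 < log (6/7) := by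
  have h5 : log (6/7) = log (24/25) + log (25/26) + log (26/27) + log (27/28) := by
    rw [← log_mul (by norm_num) (by norm_num), ← log_mul (by norm_num) (by norm_num),
      ← log_mul (by norm_num) (by norm_num)]; norm_num
  have h1 := one_sub_inv_le_log_of_pos (show (0:ℝ) < 24/25 by norm_num)
  have h2 := one_sub_inv_le_log_of_pos (show (0:ℝ) < 25/26 by norm_num)
  have h3 := one_sub_inv_le_log_of_pos (show (0:ℝ) < 26/27 by norm_num)
  have h4 := one_sub_inv_le_log_of_pos (show (0:ℝ) < 27/28 by norm_num)
  norm_num at h1 h2 h3 h4 h5 ⊢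
  linarith

/-- L ≤ 4, 1 ≤ u ≤ 2 -/
lemma case_zero {u L : ℝ} (hL : 2 ≤ L) (hL4 : L ≤ 4) (hu : 1 ≤ u) (hu2 : u ≤ 2) :
    u * (L - log L - log u) < L + log (6/7) := by
  have g2 := log_two_gt_d9
  have g2' := log_two_lt_d9
  have g67 := log67
  have h1 : 2 + (-(u * (1 + log 2))) ≥ -(u * log u) := by
    have := log_le_sub_one_of_pos (show 0 < 2 / u by positivity)
    rw [log_div (by norm_num) (by linarith)] at this
    have h : u * (log 2 - log u) ≤ u * (2 / u - 1) := mul_le_mul_of_nonneg_left this (by linarith)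
    have e : u * (2 / u - 1) = 2 - u := by field_simp
    nlinarith
  have h2 : log 2 ≤ log L := log_le_log (by norm_num) hL
  have h3 : log 4 - log L ≤ (4 - L) / 2 := by
    have := log_le_sub_one_of_pos (show 0 < 4 / L by positivity)
    rw [log_div (by norm_num) (by linarith)] at this
    have : 4 / L - 1 ≤ (4 - L) / 2 := by
      rw [div_sub_one (by linarith), div_le_div_iff₀ (by linarith) (by norm_num)]
      nlinarith
    linarith
  have l4 : log 4 = 2 * log 2 := by
    rw [show (4:ℝ) = 2 ^ 2 by norm_num, log_pow]; norm_num
  rw [l4] at h3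
  set w := L - log L with hw
  have h5 : w - log 2 + 1 < L + log (6/7) := by linarith
  have h6 : 2 * w - 2 * log 2 < L + log (6/7) := by linarith
  nlinarith

lemma case_B {u L : ℝ} (hL : 4 ≤ L) (hL4 : L ≤ 6) (hu : 1 ≤ u) (hu2 : u ≤ 3/2) :
    u * (L - log L - log u) < L + log (6/7) := by
  have g2 := log_two_gt_d9
  have g3 := log3_gt
  have g67 := log67
  have h1 : u - 1 ≤ u * log u := by
    have := one_sub_inv_le_log_of_pos (show 0 < u by linarith)
    have h : u * (1 - u⁻¹) ≤ u * log u := mul_le_mul_of_nonneg_left this (by linarith)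
    have e : u * (1 - u⁻¹) = u - 1 := by field_simp
    linarith
  have h3 : log 6 - log L ≤ (6 - L) / 3 := by
    have := log_le_sub_one_of_pos (show 0 < 6 / L by positivity)
    rw [log_div (by norm_num) (by linarith)] at this
    have : 6 / L - 1 ≤ (6 - L) / 3 := by
      rw [div_sub_one (by linarith), div_le_div_iff₀ (by linarith) (by norm_num)]
      nlinarith
    linarith
  have l6 : log 6 = log 2 + log 3 := by
    rw [← log_mul (by norm_num) (by norm_num)]; norm_num
  have h4 : log L ≤ L - 1 := log_le_sub_one_of_pos (by linarith)
  set w := L - log L with hw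
  nlinarith

lemma base_A {x y : ℝ} (hy : 4 ≤ log y) (hyx : 3/2 * log y ≤ log x) (hxy : log x ≤ 2 * log y) (hy0 : 7 ≤ y) (hyx' : y ≤ x) :
    exp (log x - log x * log (log x) / log y) < (smA x y).card := by
  have hx0 : 0 < x := by linarith
  have hyp : 0 < y := by linarith
  have ht : x / y = exp (log x - log y) := by rw [exp_sub, exp_log hx0, exp_log hyp]
  have hty : x / y ≤ y := by
    rw [ht, ← le_log_iff_exp_le hyp]; linarith
  have ht7 : 7 ≤ x / y := by
    rw [ht]
    have e1 := exp_one_gt_d9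
    have : exp 2 = exp 1 * exp 1 := by rw [← exp_add]; norm_num
    have h : exp 2 ≤ exp (log x - log y) := exp_le_exp.2 (by linarith)
    nlinarith
  set t := x / y with htd
  have hk := key (x := x) (y := y) (by linarith) (Finset.Icc 1 ⌊t⌋₊) (fun _ => y) (by
    intro k hk
    rw [Finset.mem_Icc, Nat.le_floor_iff (by linarith)] at hk
    exact ⟨hk.1, smooth_of_le hk.1 (hk.2.trans hty)⟩) (by
    intro k hk
    rw [Finset.mem_Icc, Nat.le_floor_iff (by linarith)] at hk
    refine ⟨hyp.le, le_rfl, ?_⟩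
    exact (le_div_iff₀ hyp).1 hk.2)
  rw [Finset.sum_const, Nat.card_Icc, Nat.add_sub_cancel, nsmul_eq_mul] at hk
  have hpsi := psi_half (show 5 ≤ y by linarith)
  have hfl : (7/8) * t ≤ (⌊t⌋₊ : ℝ) := by
    have h1 : (7:ℝ) ≤ (⌊t⌋₊ : ℝ) := by
      exact_mod_cast (Nat.le_floor (by exact_mod_cast ht7) : 7 ≤ ⌊t⌋₊)
    have h2 := Nat.sub_one_lt_floor t
    linarith
  have hm : (7/8 * t) * (y / 2) ≤ (smA x y).card * log x :=
    le_trans (mul_le_mul hfl hpsi (by positivity) (by positivity)) hk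
  have hx : t * y = x := by rw [htd]; field_simp
  have hl : 6 ≤ log x := by linarith
  have hl0 : 0 < log x := by linarith
  have hm2 : 7/16 * x / log x ≤ (smA x y).card := by
    rw [div_le_iff₀ hl0]; nlinarith
  refine lt_of_lt_of_le ?_ hm2
  rw [← lt_log_iff_exp_lt (by positivity), log_div (by positivity) hl0.ne', log_mul (by norm_num) hx0.ne']
  have h5 : 3/2 * log (log x) ≤ log x * log (log x) / log y := by
    rw [le_div_iff₀ (by linarith)]
    have : 0 ≤ log (log x) := log_nonneg (by linarith)
    nlinarith
  have h6 : log 6 ≤ log (log x) := log_le_log (by norm_num) hl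
  have h7 : 0 < 2 * log (7/16) + log 6 := by
    have : log ((7/16:ℝ)^2 * 6) = 2 * log (7/16) + log 6 := by
      rw [log_mul (by norm_num) (by norm_num), log_pow]; norm_num
    rw [← this]; exact log_pos (by norm_num)
  linarith

lemma base_C {x y : ℝ} (hy : 6 ≤ log y) (hxy : log x ≤ 3/2 * log y) (hy0 : 7 ≤ y) (hyx' : y ≤ x) :
    exp (log x - log x * log (log x) / log y) < (smA x y).card := by
  have hx0 : 0 < x := by linarith
  have hyp : 0 < y := by linarith
  have hlL : log y ≤ log x := log_le_log hyp hyx'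
  have hl0 : 0 < log x := by linarith
  have hE : exp (log x - log x * log (log x) / log y) ≤ x / log x := by
    rw [← le_log_iff_exp_le (by positivity), log_div hx0.ne' hl0.ne']
    have : 0 ≤ log (log x) := log_nonneg (by linarith)
    have : log (log x) ≤ log x * log (log x) / log y := by
      rw [le_div_iff₀ (by linarith)]
      nlinarith
    linarith
  refine lt_of_le_of_lt hE ?_
  have ht : x / y = exp (log x - log y) := by rw [exp_sub, exp_log hx0, exp_log hyp]
  have hty : 16 * (x / y) ≤ y := by
    have h16 : 16 ≤ exp 3 := by
      have e1 := exp_one_gt_d9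
      have : exp 3 = exp 1 * exp 1 * exp 1 := by rw [← exp_add, ← exp_add]; norm_num
      have : 2.7 * 2.7 ≤ exp 1 * exp 1 := by nlinarith
      nlinarith
    calc 16 * (x / y) ≤ exp 3 * exp (log x - log y) := by rw [ht]; gcongr
      _ = exp (3 + (log x - log y)) := by rw [exp_add]
      _ ≤ exp (log y) := exp_le_exp.2 (by linarith)
      _ = y := exp_log hyp
  have ht1 : 1 ≤ x / y := by rw [le_div_iff₀ hyp]; linarith
  have hx : (x / y) * y = x := by field_simp
  set t := x / y with htd
  have hy80 : 80 ≤ y := by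
    have h1 := add_one_le_exp (3:ℝ)
    have h2 : exp 3 * exp 3 ≤ y := by
      rw [← exp_add, ← le_log_iff_exp_le hyp]; linarith
    have h16 : 9 ≤ exp 3 := by
      have e1 := exp_one_gt_d9
      have : exp 3 = exp 1 * exp 1 * exp 1 := by rw [← exp_add, ← exp_add]; norm_num
      have : 2.7 * 2.7 ≤ exp 1 * exp 1 := by nlinarith
      nlinarith
    nlinarith
  rcases le_or_gt t 5 with h5 | h5
  · have h1 := card_ge_floor hyp.le hyx'
    have : x / log x ≤ 5 * y / 6 := by
      rw [div_le_div_iff₀ hl0 (by norm_num)]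
      have : x ≤ 5 * y := by rw [← hx]; nlinarith
      nlinarith
    linarith
  let z : ℕ → ℝ := fun k => y / 16 + (if k ≤ ⌊4 * t⌋₊ then 3 * y / 16 else 0) + (if k ≤ ⌊t⌋₊ then 3 * y / 4 else 0)
  have hM12 : ⌊t⌋₊ ≤ ⌊4 * t⌋₊ := Nat.floor_mono (by linarith)
  have hM23 : ⌊4 * t⌋₊ ≤ ⌊16 * t⌋₊ := Nat.floor_mono (by linarith)
  have hz5 : ∀ k, 5 ≤ z k := by
    intro k
    simp only [z]
    split_ifs <;> linarith
  have hk := key (x := x) (y := y) (by linarith) (Finset.Icc 1 ⌊16 * t⌋₊) z (by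
    intro k hk
    rw [Finset.mem_Icc, Nat.le_floor_iff (by linarith)] at hk
    exact ⟨hk.1, smooth_of_le hk.1 (hk.2.trans hty)⟩) (by
    intro k hk
    rw [Finset.mem_Icc, Nat.le_floor_iff (by linarith)] at hk
    refine ⟨by linarith [hz5 k], ?_, ?_⟩
    · simp only [z]
      split_ifs <;> linarith
    · simp only [z]
      split_ifs with h1 h2 h2
      · rw [Nat.le_floor_iff (by linarith)] at h2
        nlinarith
      · rw [Nat.le_floor_iff (by linarith)] at h1
        nlinarith
      · exact absurd (h2.trans hM12) h1
      · nlinarith)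
  have hs : ∑ k ∈ Finset.Icc 1 ⌊16 * t⌋₊, z k / 2 ≤ (smA x y).card * log x :=
    le_trans (Finset.sum_le_sum fun k _ => psi_half (hz5 k)) hk
  have hcard : ∀ M : ℕ, M ≤ ⌊16 * t⌋₊ → ∀ c : ℝ,
      ∑ k ∈ Finset.Icc 1 ⌊16 * t⌋₊, (if k ≤ M then c else 0) = M * c := by
    intro M hM c
    rw [← Finset.sum_filter]
    have : (Finset.Icc 1 ⌊16 * t⌋₊).filter (fun k => k ≤ M) = Finset.Icc 1 M := by
      ext k; simp only [Finset.mem_filter, Finset.mem_Icc]; omega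
    rw [this]; simp
  rw [← Finset.sum_div] at hs
  simp only [z, Finset.sum_add_distrib] at hs
  rw [hcard _ hM23, hcard _ (hM12.trans hM23)] at hs
  simp only [Finset.sum_const, Nat.card_Icc, Nat.add_sub_cancel, nsmul_eq_mul] at hs
  have f1 := Nat.sub_one_lt_floor t
  have f2 := Nat.sub_one_lt_floor (4 * t)
  have f3 := Nat.sub_one_lt_floor (16 * t)
  rw [div_lt_iff₀ hl0]
  refine lt_of_lt_of_le ?_ hs
  have g1 := mul_lt_mul_of_pos_right f1 hyp
  have g2 := mul_lt_mul_of_pos_right f2 hyp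
  have g3 := mul_lt_mul_of_pos_right f3 hyp
  have g4 : 5 * y ≤ x := by nlinarith
  have : x < (((16 * t - 1) * y) / 16 + ((4 * t - 1) * y) * 3 / 16 + ((t - 1) * y) * 3 / 4) / 2 := by
    have e : (((16 * t - 1) * y) / 16 + ((4 * t - 1) * y) * 3 / 16 + ((t - 1) * y) * 3 / 4) / 2
      = (5 / 2 * (t * y) - y) / 2 := by ring
    rw [e, hx]; linarith
  linarith

lemma base {x y : ℝ} (hy : 2 ≤ log y) (hy0 : 7 ≤ y) (hyx : y ≤ x) (hxy : log x ≤ 2 * log y) :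
    exp (log x - log x * log (log x) / log y) < (smA x y).card := by
  have hyp : 0 < y := by linarith
  have hlL : log y ≤ log x := log_le_log hyp hyx
  have hL0 : 0 < log y := by linarith
  have hu1 : 1 ≤ log x / log y := by rw [le_div_iff₀ hL0]; linarith
  have hu2 : log x / log y ≤ 2 := by rw [div_le_iff₀ hL0]; linarith
  have hE : log x - log x * log (log x) / log y
      = (log x / log y) * (log y - log (log y) - log (log x / log y)) := by
    rw [log_div (by linarith) (by linarith)]; field_simp; ring
  rcases le_or_gt (log y) 4 with h4 | h4
  · apply via_floor hy0 hyx
    rw [hE]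
    exact case_zero hy h4 hu1 hu2
  rcases le_or_gt (3/2 * log y) (log x) with h | h
  · exact base_A h4.le h hxy hy0 hyx
  rcases le_or_gt (log y) 6 with h6 | h6
  · apply via_floor hy0 hyx
    rw [hE]
    exact case_B h4.le h6 hu1 (by rw [div_le_iff₀ hL0]; linarith)
  · exact base_C h6.le h.le hy0 hyx

lemma main_ind (y : ℝ) (hy : 2 ≤ log y) (hy0 : 7 ≤ y) (n : ℕ) : ∀ x : ℝ, y ≤ x →
    log x ≤ (n + 2) * log y →
    exp (log x - log x * log (log x) / log y) < (smA x y).card := by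
  have hyp : 0 < y := by linarith
  have hL0 : 0 < log y := by linarith
  induction n with
  | zero => intro x h1 h2; exact base hy hy0 h1 (by simpa using h2)
  | succ n ih =>
    intro x hyx hxn
    rcases le_or_gt (log x) (2 * log y) with h | h
    · exact base hy hy0 hyx h
    have hx0 : 0 < x := by linarith
    have hlx : log (x / y) = log x - log y := log_div hx0.ne' hyp.ne'
    have hyxy : y ≤ x / y := by
      rw [← log_le_log_iff hyp (by positivity), hlx]; linarith
    have hi := ih (x / y) hyxy (by rw [hlx]; push_cast at hxn; linarith)
    rw [hlx] at hi
    have hk := key (x := x) (y := y) (by linarith) (smA (x / y) y) (fun _ => y) (by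
      intro k hk
      rw [mem_smA (by positivity)] at hk
      exact ⟨hk.1, hk.2.2⟩) (by
      intro k hk
      rw [mem_smA (by positivity)] at hk
      exact ⟨hyp.le, le_rfl, (le_div_iff₀ hyp).1 hk.2.1⟩)
    rw [Finset.sum_const, nsmul_eq_mul] at hk
    have hpsi := psi_half (show 5 ≤ y by linarith)
    set l := log x
    set L := log y with hLdef
    have hl0 : 0 < l := by linarith
    have hlL : 0 < l - L := by linarith
    have hm : exp (l - L - (l - L) * log (l - L) / L) * (y / 2) < (smA x y).card * l := by
      refine lt_of_lt_of_le (mul_lt_mul_of_pos_right hi (by positivity)) (le_trans ?_ hk)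
      exact mul_le_mul_of_nonneg_left hpsi (by positivity)
    rw [← div_lt_iff₀ hl0] at hm
    refine lt_of_le_of_lt ?_ hm
    rw [← le_log_iff_exp_le (by positivity), log_div (by positivity) hl0.ne',
      log_mul (by positivity) (by positivity), log_exp, log_div hyp.ne' (by norm_num), ← hLdef]
    -- Bernoulli
    have hv : 1 ≤ (l - L) / L := by rw [le_div_iff₀ hL0]; linarith
    have hB := one_add_mul_self_le_rpow_one_add (s := L / (l - L)) (by
      have : 0 ≤ L / (l - L) := by positivity
      linarith) hv
    have e1 : 1 + (l - L) / L * (L / (l - L)) = 2 := by field_simp; norm_num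
    have e2 : 1 + L / (l - L) = l / (l - L) := by field_simp; ring
    rw [e1, e2] at hB
    have hB2 := log_le_log (by norm_num) hB
    rw [log_rpow (by positivity), log_div hl0.ne' hlL.ne'] at hB2
    have e3 : l * log l / L = (l - L) / L * log l + log l := by field_simp; ring
    have e4 : (l - L) * log (l - L) / L = (l - L) / L * log (l - L) := by ring
    rw [e3, e4]
    linarith

/-- Konyagin–Pomerance: for `x ≥ 4` and `2 ≤ y ≤ x`, the number of `y`-smooth
positive integers up to `x` exceeds `x^(1 - log log x / log y)`. -/
theorem stmt10 (x y : ℝ) (hx : 4 ≤ x) (hy2 : 2 ≤ y) (hyx : y ≤ x) :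
    x ^ (1 - Real.log (Real.log x) / Real.log y) <
      (Nat.card {m : ℕ //
        0 < m ∧ (m : ℝ) ≤ x ∧ ∀ p : ℕ, p.Prime → p ∣ m → (p : ℝ) ≤ y} : ℝ) := by
  rw [smA_card (by linarith), exp_form (by linarith)]
  rcases lt_or_ge (log y) 2 with h | h
  · exact small_case hx hy2 h
  have hy0 : 7 ≤ y := by
    have e1 := exp_one_gt_d9
    have : exp 2 = exp 1 * exp 1 := by rw [← exp_add]; norm_num
    have h : exp 2 ≤ y := by rwa [← le_log_iff_exp_le (by linarith)]
    nlinarith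
  obtain ⟨n, hn⟩ := exists_nat_ge (log x / log y)
  refine main_ind y h hy0 n x hyx ?_
  rw [div_le_iff₀ (by linarith)] at hn
  nlinarith
end

section
/- Let n be a positive integer, set c(n) = n² for n ≥ 2 and c(1) = 2, and b(n) = 4(log n)² for n ≥ 3, b(1) = 2, b(2) = 3. Then every prime dividing gcd{ h^n − 1 : h ∈ ℤ, 1 < h ≤ b(n) } is less than c(n). -/
/-- `b(n) = 4(log n)²` for `n ≥ 3`, with `b(1) = 2`, `b(2) = 3`. -/
noncomputable def bKP (n : ℕ) : ℝ :=
  if n = 1 then 2 else if n = 2 then 3 else 4 * (Real.log n) ^ 2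

/-- `c(n) = n²` for `n ≥ 2`, with `c(1) = 2`. -/
noncomputable def cKP (n : ℕ) : ℝ := if n = 1 then 2 else (n : ℝ) ^ 2

lemma KP_core (n ℓ : ℕ) (hn : 0 < n) (hℓ : ℓ.Prime) (S : Finset ℕ)
    (hS : ∀ m ∈ S, (m : ZMod ℓ) ^ n = 1 ∧ m < ℓ) : S.card ≤ n := by
  have : Fact ℓ.Prime := ⟨hℓ⟩
  classical
  have h1 : (S.image (fun m : ℕ => (m : ZMod ℓ))).card = S.card := by
    apply Finset.card_image_of_injOn
    intro a ha b hb hab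
    have h := (ZMod.natCast_eq_natCast_iff' a b ℓ).1 hab
    rwa [Nat.mod_eq_of_lt (hS a ha).2, Nat.mod_eq_of_lt (hS b hb).2] at h
  rw [← h1]
  have h2 : S.image (fun m : ℕ => (m : ZMod ℓ)) ⊆ (Polynomial.nthRoots n (1 : ZMod ℓ)).toFinset := by
    intro x hx
    obtain ⟨m, hm, rfl⟩ := Finset.mem_image.1 hx
    rw [Multiset.mem_toFinset, Polynomial.mem_nthRoots hn]
    exact (hS m hm).1
  exact (Finset.card_le_card h2).trans
    ((Multiset.toFinset_card_le _).trans (Polynomial.card_nthRoots n _))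

lemma KP_count (s : Multiset ℕ) (hs : ∀ x ∈ s, x = 1 ∨ x.Prime) (p : ℕ) (hp : p.Prime) :
    s.prod.factorization p = s.count p ∧ s.prod ≠ 0 := by
  induction s using Multiset.induction with
  | empty => simp
  | cons a s ih =>
    obtain ⟨h1, h2⟩ := ih (fun x hx => hs x (Multiset.mem_cons_of_mem hx))
    have ha := hs a (Multiset.mem_cons_self a s)
    have ha0 : a ≠ 0 := by
      rcases ha with h | h
      · omega
      · exact h.ne_zero
    refine ⟨?_, by simp [ha0, h2]⟩
    rw [Multiset.prod_cons, Nat.factorization_mul ha0 h2, Multiset.count_cons, Finsupp.add_apply, h1]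
    rcases ha with h | h
    · subst h
      simp [hp.ne_one]
    · rw [h.factorization, Finsupp.single_apply]
      split_ifs <;> grind

lemma KP_inj (s t : Multiset ℕ) (hs : ∀ x ∈ s, x = 1 ∨ x.Prime) (ht : ∀ x ∈ t, x = 1 ∨ x.Prime)
    (hc : s.card = t.card) (h : s.prod = t.prod) : s = t := by
  have key : s.filter (· ≠ 1) = t.filter (· ≠ 1) := by
    ext p
    rw [Multiset.count_filter, Multiset.count_filter]
    split_ifs with h1
    · by_cases hp : p.Prime
      · rw [← (KP_count s hs p hp).1, ← (KP_count t ht p hp).1, h]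
      · rw [Multiset.count_eq_zero_of_notMem, Multiset.count_eq_zero_of_notMem]
        · intro hx; rcases ht p hx with h | h <;> contradiction
        · intro hx; rcases hs p hx with h | h <;> contradiction
    · rfl
  have e1 := Multiset.filter_add_not (· ≠ 1) s
  have e2 := Multiset.filter_add_not (· ≠ 1) t
  have c1 := congrArg Multiset.card e1
  have c2 := congrArg Multiset.card e2
  rw [Multiset.card_add] at c1 c2
  rw [← e1, ← e2, key]
  congr 1
  have r : ∀ u : Multiset ℕ, u.filter (fun x => ¬ (x ≠ 1)) =
      Multiset.replicate (u.filter (fun x => ¬ (x ≠ 1))).card 1 := by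
    intro u
    rw [Multiset.eq_replicate]
    refine ⟨rfl, fun b hb => ?_⟩
    have := (Multiset.mem_filter.1 hb).2
    simpa using this
  rw [r s, r t]
  congr 1
  rw [key] at c1
  omega

lemma KP_prod (n ℓ z k : ℕ) (hn : 0 < n) (hℓ : ℓ.Prime)
    (hz : ∀ h : ℕ, 1 ≤ h → h ≤ z → (h : ZMod ℓ) ^ n = 1) (hz1 : 1 ≤ z) (hk : z ^ k < ℓ) :
    (z.primeCounting + k).choose k ≤ n := by
  classical
  set A : Finset ℕ := insert 1 (Nat.primesLE z) with hA
  have hAc : A.card = z.primeCounting + 1 := by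
    rw [hA, Finset.card_insert_of_notMem, Nat.primesLE_card_eq_primeCounting]
    simp [Nat.mem_primesLE, Nat.not_prime_one]
  have hAm : ∀ x ∈ A, (x = 1 ∨ x.Prime) ∧ 1 ≤ x ∧ x ≤ z := by
    intro x hx
    rcases Finset.mem_insert.1 hx with h | h
    · subst h; exact ⟨Or.inl rfl, le_rfl, hz1⟩
    · rw [Nat.mem_primesLE] at h
      exact ⟨Or.inr h.2, h.2.one_lt.le, h.1⟩
  set f : Sym A k → ℕ := fun s => ((s.1 : Multiset A).map Subtype.val).prod with hf
  have finj : Function.Injective f := by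
    intro s t hst
    have := KP_inj _ _ ?_ ?_ ?_ hst
    · exact Sym.coe_injective (Multiset.map_injective Subtype.val_injective this)
    · intro x hx
      obtain ⟨y, _, rfl⟩ := Multiset.mem_map.1 hx
      exact (hAm y y.2).1
    · intro x hx
      obtain ⟨y, _, rfl⟩ := Multiset.mem_map.1 hx
      exact (hAm y y.2).1
    · simp
  have hcard : (Finset.univ.image f).card = (z.primeCounting + k).choose k := by
    rw [Finset.card_image_of_injective _ finj, Finset.card_univ, Sym.card_sym_eq_choose,
      Fintype.card_coe, hAc]
    congr 1
    omega
  rw [← hcard]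
  apply KP_core n ℓ hn hℓ
  intro m hm
  obtain ⟨s, _, rfl⟩ := Finset.mem_image.1 hm
  constructor
  · rw [hf]
    have : ∀ u : Multiset A, (((u.map Subtype.val).prod : ℕ) : ZMod ℓ) ^ n = 1 := by
      intro u
      induction u using Multiset.induction with
      | empty => simp
      | cons a u ih =>
        rw [Multiset.map_cons, Multiset.prod_cons, Nat.cast_mul, mul_pow, ih, mul_one]
        exact hz a (hAm a a.2).2.1 (hAm a a.2).2.2
    exact this _
  · refine lt_of_le_of_lt ?_ hk
    have := Multiset.prod_le_pow_card ((s.1 : Multiset A).map Subtype.val) z (by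
      intro x hx
      obtain ⟨y, _, rfl⟩ := Multiset.mem_map.1 hx
      exact (hAm y y.2).2.2)
    simpa [hf] using this

def KPQ : ℕ := 4014476939333036189094441199026045136645885247730

def KPlist : List ℕ := [2, 3, 5, 7, 11, 13, 17, 19, 23, 29, 31, 37, 41, 43, 47, 53, 59, 61, 67,
  71, 73, 79, 83, 89, 97, 101, 103, 107, 109, 113, 127]

def KPtest (z m : ℕ) : Bool :=
  Nat.ble m z && (Nat.ble m 17160 && (Nat.ble 2 m &&
    (Nat.beq (Nat.gcd m KPQ) 1 || (Nat.ble m 127 && KPlist.contains m))))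

def KPcnt (z : ℕ) : ℕ → ℕ → ℕ
  | 0, lo => cond (KPtest z lo) 1 0
  | j + 1, lo => KPcnt z j lo + KPcnt z j (lo + 2 ^ j)

lemma KP_Q : ∀ p < 131, p.Prime → p ∣ KPQ := by
  intro p hp hpp
  unfold KPQ
  interval_cases p <;> revert hpp <;> norm_num

lemma KP_test (z m : ℕ) (h : KPtest z m = true) : m.Prime ∧ m ≤ z := by
  simp only [KPtest, Bool.and_eq_true, Bool.or_eq_true, Nat.ble_eq, Nat.beq_eq] at h
  obtain ⟨h1, h2, h3, h4⟩ := h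
  refine ⟨?_, h1⟩
  rcases h4 with h4 | ⟨_, h4⟩
  · by_contra hnp
    have h5 := Nat.minFac_sq_le_self (by omega) hnp
    have h6 : m.minFac < 131 := by
      by_contra h6
      have := Nat.pow_le_pow_left (not_lt.1 h6) 2
      omega
    have hp : m.minFac.Prime := Nat.minFac_prime (by omega)
    have h7 := Nat.dvd_gcd (Nat.minFac_dvd m) (KP_Q _ h6 hp)
    rw [h4] at h7
    exact hp.one_lt.ne' (Nat.dvd_one.1 h7)
  · have h5 : m ∈ KPlist := by simpa using h4
    simp only [KPlist, List.mem_cons, List.not_mem_nil, or_false] at h5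
    rcases h5 with h | h | h | h | h | h | h | h | h | h | h | h | h | h | h | h | h | h | h | h | h
      | h | h | h | h | h | h | h | h | h | h <;> subst h <;> norm_num

lemma KP_cnt (z j lo : ℕ) :
    KPcnt z j lo ≤ ((Finset.Ico lo (lo + 2 ^ j)).filter (fun m => m.Prime ∧ m ≤ z)).card := by
  induction j generalizing lo with
  | zero =>
    rw [KPcnt]
    cases h : KPtest z lo with
    | false => simp
    | true =>
      have := KP_test z lo h
      simp [Finset.filter_singleton, this]
  | succ j ih =>
    rw [KPcnt]
    refine (add_le_add (ih lo) (ih (lo + 2 ^ j))).trans ?_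
    rw [← Finset.card_union_of_disjoint]
    · apply Finset.card_le_card
      intro m hm
      simp only [Finset.mem_union, Finset.mem_filter, Finset.mem_Ico] at hm ⊢
      rw [pow_succ]
      rcases hm with ⟨h1, h2⟩ | ⟨h1, h2⟩
      · exact ⟨by omega, h2⟩
      · exact ⟨by omega, h2⟩
    · rw [Finset.disjoint_left]
      intro m hm hm'
      simp only [Finset.mem_filter, Finset.mem_Ico] at hm hm'
      omega

lemma KP_pi (z j : ℕ) : KPcnt z j 0 ≤ z.primeCounting := by
  refine (KP_cnt z j 0).trans ?_
  rw [← Nat.primesLE_card_eq_primeCounting]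
  apply Finset.card_le_card
  intro m hm
  simp only [Finset.mem_filter] at hm
  rw [Nat.mem_primesLE]
  exact ⟨hm.2.2, hm.2.1⟩

lemma KP_logb (n a z : ℕ) (hn : 2 ^ a ≤ n) (hz : z * 10 ^ 8 ≤ 4 * (6931 * a) ^ 2) :
    (z : ℝ) ≤ 4 * Real.log n ^ 2 := by
  have h1 : (a : ℝ) * Real.log 2 ≤ Real.log n := by
    rw [← Real.log_pow]
    apply Real.log_le_log (by positivity)
    exact_mod_cast hn
  have h2 : (a : ℝ) * 0.6931 ≤ Real.log n := by
    have := Real.log_two_gt_d9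
    have h0 : (0 : ℝ) ≤ a := by positivity
    nlinarith
  have h3 : (z : ℝ) * 10 ^ 8 ≤ 4 * (6931 * a) ^ 2 := by exact_mod_cast hz
  have h4 : ((a : ℝ) * 0.6931) ^ 2 ≤ Real.log n ^ 2 := by gcongr
  nlinarith

/-- the predicate that we refute -/
def KPbad (n ℓ : ℕ) : Prop :=
  0 < n ∧ ℓ.Prime ∧ n ^ 2 < ℓ ∧
    ∀ h : ℕ, 1 ≤ h → (h : ℝ) ≤ 4 * Real.log n ^ 2 → (h : ZMod ℓ) ^ n = 1

lemma KP_mile (n ℓ : ℕ) (hb : KPbad n ℓ) (a z k j a' : ℕ) (h1 : 2 ^ a ≤ n)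
    (hz1 : 1 ≤ z) (hz : z * 10 ^ 8 ≤ 4 * (6931 * a) ^ 2) (hk : z ^ k ≤ 4 ^ a)
    (P : ℕ) (hP : P ≤ KPcnt z j 0)
    (hc : 2 ^ a' ≤ (P + k).choose k) : 2 ^ a' ≤ n := by
  obtain ⟨hn, hℓ, hlt, hh⟩ := hb
  have hzl := KP_logb n a z h1 hz
  have h4 : z ^ k < ℓ := by
    refine lt_of_le_of_lt (hk.trans ?_) hlt
    calc 4 ^ a = (2 ^ a) ^ 2 := by rw [← pow_mul, mul_comm, pow_mul]; norm_num
      _ ≤ n ^ 2 := Nat.pow_le_pow_left h1 2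
  have := KP_prod n ℓ z k hn hℓ (fun h h1 h2 => hh h h1 (le_trans (by exact_mod_cast h2) hzl)) hz1 h4
  refine hc.trans (le_trans ?_ this)
  exact Nat.choose_le_choose k (Nat.add_le_add_right (hP.trans (KP_pi z j)) k)

def KPS (z X : ℕ) : Finset ℕ :=
  (Finset.range (X + 1)).filter (fun m => (List.range (z + 1)).any (fun d =>
    Nat.ble 1 d && (Nat.ble 1 (m / d) && (Nat.ble (m / d) z && Nat.beq (d * (m / d)) m))) = true)

lemma KP_small (n ℓ : ℕ) (hb : KPbad n ℓ) (a z X a' : ℕ) (h1 : 2 ^ a ≤ n)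
    (hz : z * 10 ^ 8 ≤ 4 * (6931 * a) ^ 2) (hk : X ≤ 4 ^ a)
    (hc : 2 ^ a' ≤ (KPS z X).card) : 2 ^ a' ≤ n := by
  obtain ⟨hn, hℓ, hlt, hh⟩ := hb
  have hzl := KP_logb n a z h1 hz
  refine hc.trans (KP_core n ℓ hn hℓ _ ?_)
  intro m hm
  simp only [KPS, Finset.mem_filter, Finset.mem_range, List.any_eq_true, List.mem_range,
    Bool.and_eq_true, Nat.ble_eq, Nat.beq_eq] at hm
  obtain ⟨hmX, d, hd, hd1, hd2, hd3, hdm⟩ := hm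
  have hc : ∀ h : ℕ, 1 ≤ h → h ≤ z → (h : ZMod ℓ) ^ n = 1 :=
    fun h h1 h2 => hh h h1 (le_trans (by exact_mod_cast h2) hzl)
  constructor
  · rw [← hdm, Nat.cast_mul, mul_pow, hc d hd1 (by omega), hc _ hd2 hd3, one_mul]
  · refine lt_of_le_of_lt ((by omega : m ≤ X).trans (hk.trans ?_)) hlt
    calc 4 ^ a = (2 ^ a) ^ 2 := by rw [← pow_mul, mul_comm, pow_mul]; norm_num
      _ ≤ n ^ 2 := Nat.pow_le_pow_left h1 2

lemma KP_chain (n ℓ : ℕ) (hb : KPbad n ℓ) (h : 2 ^ 2 ≤ n) : 2 ^ 109 ≤ n := by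
  have h := KP_small n ℓ hb 2 7 16 3 h (by norm_num) (by norm_num) (by decide +kernel)
  have h := KP_small n ℓ hb 3 17 64 5 h (by norm_num) (by norm_num) (by decide +kernel)
  have h := KP_small n ℓ hb 5 48 200 7 h (by norm_num) (by norm_num) (by decide +kernel)
  have h := KP_small n ℓ hb 7 94 800 9 h (by norm_num) (by norm_num) (by decide +kernel)
  have h := KP_mile n ℓ hb 9 64 3 7 10 h (by norm_num) (by norm_num) (by norm_num)
    18 (by decide +kernel) (by decide +kernel)
  have h := KP_mile n ℓ hb 10 101 3 7 11 h (by norm_num) (by norm_num) (by norm_num)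
    26 (by decide +kernel) (by decide +kernel)
  have h := KP_mile n ℓ hb 11 161 3 8 13 h (by norm_num) (by norm_num) (by norm_num)
    37 (by decide +kernel) (by decide +kernel)
  have h := KP_mile n ℓ hb 13 324 3 9 15 h (by norm_num) (by norm_num) (by norm_num)
    66 (by decide +kernel) (by decide +kernel)
  have h := KP_mile n ℓ hb 15 181 4 8 17 h (by norm_num) (by norm_num) (by norm_num)
    42 (by decide +kernel) (by decide +kernel)
  have h := KP_mile n ℓ hb 17 362 4 9 20 h (by norm_num) (by norm_num) (by norm_num)
    72 (by decide +kernel) (by decide +kernel)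
  have h := KP_mile n ℓ hb 20 768 4 10 23 h (by norm_num) (by norm_num) (by norm_num)
    135 (by decide +kernel) (by decide +kernel)
  have h := KP_mile n ℓ hb 23 588 5 10 26 h (by norm_num) (by norm_num) (by norm_num)
    107 (by decide +kernel) (by decide +kernel)
  have h := KP_mile n ℓ hb 26 1298 5 11 31 h (by norm_num) (by norm_num) (by norm_num)
    211 (by decide +kernel) (by decide +kernel)
  have h := KP_mile n ℓ hb 31 1290 6 11 36 h (by norm_num) (by norm_num) (by norm_num)
    209 (by decide +kernel) (by decide +kernel)
  have h := KP_mile n ℓ hb 36 2490 6 12 41 h (by norm_num) (by norm_num) (by norm_num)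
    367 (by decide +kernel) (by decide +kernel)
  have h := KP_mile n ℓ hb 41 3230 7 12 49 h (by norm_num) (by norm_num) (by norm_num)
    457 (by decide +kernel) (by decide +kernel)
  have h := KP_mile n ℓ hb 49 4613 8 13 59 h (by norm_num) (by norm_num) (by norm_num)
    623 (by decide +kernel) (by decide +kernel)
  have h := KP_mile n ℓ hb 59 6688 9 13 69 h (by norm_num) (by norm_num) (by norm_num)
    861 (by decide +kernel) (by decide +kernel)
  have h := KP_mile n ℓ hb 69 5978 11 13 80 h (by norm_num) (by norm_num) (by norm_num)
    781 (by decide +kernel) (by decide +kernel)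
  have h := KP_mile n ℓ hb 80 10321 12 14 94 h (by norm_num) (by norm_num) (by norm_num)
    1266 (by decide +kernel) (by decide +kernel)
  have h := KP_mile n ℓ hb 94 16978 13 15 109 h (by norm_num) (by norm_num) (by norm_num)
    1956 (by decide +kernel) (by decide +kernel)
  exact h

lemma KP_fact (k : ℕ) (hk : 1 ≤ k) :
    (k.factorial : ℝ) ≤ Real.exp 1 * √k * (k / Real.exp 1) ^ k := by
  have h := Stirling.stirlingSeq'_antitone (Nat.zero_le (k - 1))
  simp only [Function.comp, Nat.succ_eq_add_one, Nat.sub_add_cancel hk, zero_add,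
    Stirling.stirlingSeq_one] at h
  unfold Stirling.stirlingSeq at h
  have hk0 : (0 : ℝ) < k := by exact_mod_cast hk
  rw [div_le_iff₀ (by positivity)] at h
  rw [Real.sqrt_mul (by norm_num)] at h
  have h2 : (√2 : ℝ) ≠ 0 := by positivity
  calc _ ≤ _ := h
    _ = _ := by field_simp

lemma KP_exp (k : ℕ) (hk : 15 ≤ k) : (3 / 2 : ℝ) * (k + 1) ^ 3 < (1.88 : ℝ) ^ k := by
  induction k, hk using Nat.le_induction with
  | base => norm_num
  | succ k hk ih =>
    rw [pow_succ (1.88 : ℝ)]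
    have : (15 : ℝ) ≤ k := by exact_mod_cast hk
    push_cast
    have h3 : ((k : ℝ) + 1 + 1) ^ 3 ≤ 1.88 * (k + 1) ^ 3 := by
      have : ((k : ℝ) + 1 + 1) ≤ 17 / 16 * (k + 1) := by linarith
      calc _ ≤ (17 / 16 * ((k : ℝ) + 1)) ^ 3 := by gcongr
        _ = (17/16)^3 * ((k : ℝ) + 1) ^ 3 := by ring
        _ ≤ _ := by gcongr; norm_num
    have h4 := mul_lt_mul_of_pos_right ih (by norm_num : (0 : ℝ) < 1.88)
    linarith

lemma KP_large (n : ℕ) (hn : 2 ^ 109 ≤ n) :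
    ∃ k z : ℕ, 1 ≤ z ∧ (z : ℝ) ≤ 4 * Real.log n ^ 2 ∧ z ^ k ≤ n ^ 2 ∧
      n < (z.primeCounting + k).choose k := by
  have hn0 : (0 : ℝ) < n := by
    have : 0 < n := lt_of_lt_of_le (by norm_num) hn
    exact_mod_cast this
  have hL0 : 151 ≤ 2 * Real.log n := by
    have h1 : Real.log ((2 : ℝ) ^ 109) ≤ Real.log n := by
      apply Real.log_le_log (by positivity)
      exact_mod_cast hn
    rw [Real.log_pow] at h1
    have := Real.log_two_gt_d9
    push_cast at h1
    linarith
  set L := 2 * Real.log n with hL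
  have hLpos : 0 < L := by linarith
  set lam := Real.log L with hlam
  have hexpL : Real.exp lam = L := Real.exp_log hLpos
  have hy : 4 * Real.log n ^ 2 = L ^ 2 := by rw [hL]; ring
  have hlam1 : 1 ≤ lam := by
    rw [hlam, Real.le_log_iff_exp_le hLpos]
    linarith [Real.exp_one_lt_d9]
  -- log L ≤ L / 30
  have hlam30 : 30 * lam ≤ L := by
    have h1 : Real.log (L / Real.exp 5) ≤ L / Real.exp 5 - 1 :=
      Real.log_le_sub_one_of_pos (by positivity)
    rw [Real.log_div hLpos.ne' (Real.exp_pos _).ne', Real.log_exp] at h1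
    have h5 : (148 : ℝ) ≤ Real.exp 5 := by
      have : Real.exp 5 = Real.exp 1 ^ 5 := by rw [← Real.exp_nat_mul]; norm_num
      rw [this]
      calc (148 : ℝ) ≤ 2.7182818283 ^ 5 := by norm_num
        _ ≤ _ := by gcongr; exact Real.exp_one_gt_d9.le
    have h6 : L / Real.exp 5 ≤ L / 148 := by gcongr
    linarith
  -- log L ≤ 2 √L / e
  have hsq : lam ≤ 2 * (√L / Real.exp 1) := by
    have h1 : Real.log (√L / Real.exp 1) ≤ √L / Real.exp 1 - 1 :=
      Real.log_le_sub_one_of_pos (by positivity)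
    rw [Real.log_div (by positivity) (Real.exp_pos _).ne', Real.log_exp,
      Real.log_sqrt hLpos.le] at h1
    linarith
  set k := ⌊L / (2 * lam)⌋₊ with hk
  have hk1 : (k : ℝ) * (2 * lam) ≤ L := by
    rw [← le_div_iff₀ (by positivity)]
    exact Nat.floor_le (by positivity)
  have hk2 : L < ((k : ℝ) + 1) * (2 * lam) := by
    rw [← div_lt_iff₀ (by positivity)]
    exact Nat.lt_floor_add_one _
  have hk15 : 15 ≤ k := by
    apply Nat.le_floor
    rw [le_div_iff₀ (by positivity)]
    push_cast
    linarith
  have hk15' : (15 : ℝ) ≤ k := by exact_mod_cast hk15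
  set z := ⌊L ^ 2⌋₊ with hz
  have hzL : (z : ℝ) ≤ L ^ 2 := Nat.floor_le (by positivity)
  have hnexp : (n : ℝ) = Real.exp (L / 2) := by
    rw [hL, mul_div_cancel_left₀ _ (by norm_num : (2:ℝ) ≠ 0), Real.exp_log hn0]
  clear_value L lam
  refine ⟨k, z, ?_, hy ▸ hzL, ?_, ?_⟩
  · apply Nat.le_floor
    push_cast
    nlinarith
  · have : ((z : ℝ)) ^ k ≤ (n : ℝ) ^ 2 := by
      calc (z : ℝ) ^ k ≤ (L ^ 2) ^ k := by gcongr
        _ = Real.exp ((k : ℝ) * (2 * lam)) := by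
            rw [Real.exp_nat_mul, two_mul, Real.exp_add, hexpL, ← sq]
        _ ≤ Real.exp L := Real.exp_le_exp.2 hk1
        _ = (n : ℝ) ^ 2 := by
            rw [hnexp, ← Real.exp_nat_mul]; congr 1; push_cast; ring
    exact_mod_cast this
  · -- main inequality
    have hpi := Chebyshev.pi_ge' (x := L ^ 2) (by nlinarith)
    have hlogy : Real.log (L ^ 2) = 2 * lam := by rw [Real.log_pow, hlam]; norm_num
    rw [hlogy, ← hz] at hpi
    have hlog2 : Real.log (L ^ 2 + 2) ≤ 2 * lam + 1 := by
      rw [← hlogy, ← sub_le_iff_le_add', ← Real.log_div (by positivity) (by positivity)]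
      refine (Real.log_le_sub_one_of_pos (by positivity)).trans ?_
      rw [sub_le_iff_le_add, div_le_iff₀ (by positivity)]
      nlinarith
    have hq : 0.692 * L ^ 2 / (2 * lam) ≤ (z.primeCounting : ℝ) + 1 := by
      rw [div_le_iff₀ (by positivity)] at hpi ⊢
      have := Real.log_two_gt_d9
      have := Real.log_two_lt_d9
      nlinarith
    have hasc : (z.primeCounting + 1) ^ k ≤ k.factorial * (z.primeCounting + k).choose k := by
      rw [← Nat.ascFactorial_eq_factorial_mul_choose]
      exact Nat.pow_succ_le_ascFactorial _ _
    have hasc' : ((z.primeCounting : ℝ) + 1) ^ k ≤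
        k.factorial * ((z.primeCounting + k).choose k : ℕ) := by exact_mod_cast hasc
    have hfac := KP_fact k (by omega)
    have he := Real.exp_one_gt_d9
    have he' := Real.exp_one_lt_d9
    have hLk : L ≤ 2.2 * ((k : ℝ) + 1) ^ 2 := by
      have hs : √L * √L = L := Real.mul_self_sqrt hLpos.le
      have hsp : 0 < √L := by positivity
      have h2 : lam ≤ 2 * (√L / 2.7) := by
        refine hsq.trans ?_
        gcongr
        linarith
      have h3 : √L ≤ (4 / 2.7) * ((k : ℝ) + 1) := by
        have : √L * √L ≤ √L * ((4 / 2.7) * ((k : ℝ) + 1)) := by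
          rw [hs]
          calc L ≤ ((k : ℝ) + 1) * (2 * lam) := hk2.le
            _ ≤ ((k : ℝ) + 1) * (2 * (2 * (√L / 2.7))) := by gcongr
            _ = _ := by ring
        exact le_of_mul_le_mul_left this hsp
      rw [← hs]
      calc √L * √L ≤ ((4 / 2.7) * ((k : ℝ) + 1)) * ((4 / 2.7) * ((k : ℝ) + 1)) := by gcongr
        _ = (4 / 2.7)^2 * ((k : ℝ) + 1) ^ 2 := by ring
        _ ≤ _ := by gcongr; norm_num
    have hsk : √(k : ℝ) ≤ ((k : ℝ) + 1) / 4 := by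
      rw [Real.sqrt_le_left (by positivity)]
      nlinarith
    have hfin : L * (Real.exp 1 * √k) < (0.692 * Real.exp 1) ^ k := by
      calc L * (Real.exp 1 * √k) ≤ (2.2 * ((k : ℝ) + 1) ^ 2) * (2.72 * (((k : ℝ) + 1) / 4)) := by
            have : Real.exp 1 ≤ 2.72 := by linarith
            gcongr
        _ = (2.2 * 2.72 / 4) * ((k : ℝ) + 1) ^ 3 := by ring
        _ ≤ 3 / 2 * ((k : ℝ) + 1) ^ 3 :=
            mul_le_mul_of_nonneg_right (by norm_num) (by positivity)
        _ < 1.88 ^ k := KP_exp k hk15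
        _ ≤ _ := by gcongr; linarith
    have hnL : (n : ℝ) ≤ L ^ (k + 1) := by
      rw [hnexp, ← hexpL, ← Real.exp_nat_mul, hexpL]
      apply Real.exp_le_exp.2
      push_cast
      linarith
    have hmain : (n : ℝ) * k.factorial < ((z.primeCounting : ℝ) + 1) ^ k := by
      have hkl : (k : ℝ) ≤ L / (2 * lam) := by rwa [le_div_iff₀ (by positivity)]
      have hpos : 0 < L / (2 * lam) := by positivity
      calc (n : ℝ) * k.factorial
          ≤ L ^ (k + 1) * (Real.exp 1 * √k * (k / Real.exp 1) ^ k) := by gcongr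
        _ ≤ L ^ (k + 1) * (Real.exp 1 * √k * ((L / (2 * lam)) / Real.exp 1) ^ k) := by gcongr
        _ = (L * (L / (2 * lam)) / Real.exp 1) ^ k * (L * (Real.exp 1 * √k)) := by
            rw [pow_succ, mul_div_assoc, mul_pow]; ring
        _ < (L * (L / (2 * lam)) / Real.exp 1) ^ k * (0.692 * Real.exp 1) ^ k := by gcongr
        _ = (0.692 * L ^ 2 / (2 * lam)) ^ k := by
            rw [← mul_pow]; congr 1; field_simp
        _ ≤ _ := by gcongr
    have : (k.factorial : ℝ) * n < k.factorial * ((z.primeCounting + k).choose k : ℕ) := by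
      linarith
    have := lt_of_mul_lt_mul_left this (by positivity)
    exact_mod_cast this

/-- Every prime dividing `gcd{h^n − 1 : 1 < h ≤ b(n)}` is less than `c(n)`. -/
theorem stmt11 (n : ℕ) (hn : 0 < n) (ℓ : ℕ) (hℓ : ℓ.Prime)
    (hdvd : ∀ h : ℕ, 1 < h → (h : ℝ) ≤ bKP n → (ℓ : ℤ) ∣ (h : ℤ) ^ n - 1) :
    (ℓ : ℝ) < cKP n := by
  have hco : ∀ a b : ℕ, Nat.Coprime a b → (ℓ : ℤ) ∣ a → (ℓ : ℤ) ∣ b → False := by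
    intro a b hab ha hb
    have h := Nat.dvd_gcd (Int.natCast_dvd_natCast.1 ha) (Int.natCast_dvd_natCast.1 hb)
    rw [hab] at h
    exact hℓ.one_lt.ne' (Nat.dvd_one.1 h)
  by_cases h1 : n = 1
  · subst h1
    have h2 := hdvd 2 (by norm_num) (by norm_num [bKP])
    exact (hco 1 1 (by norm_num) (by simpa using h2) (by simpa using h2)).elim
  by_cases h2 : n = 2
  · subst h2
    have h2 := hdvd 2 (by norm_num) (by norm_num [bKP])
    have h3 := hdvd 3 (by norm_num) (by norm_num [bKP])
    exact (hco 3 8 (by norm_num) (by simpa using h2) (by simpa using h3)).elim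
  have hb : bKP n = 4 * Real.log n ^ 2 := by simp [bKP, h1, h2]
  rw [hb] at hdvd
  by_cases h3 : n = 3
  · subst h3
    have hl : 1 ≤ Real.log (3 : ℕ) := by
      rw [Real.le_log_iff_exp_le (by norm_num)]
      have := Real.exp_one_lt_d9
      push_cast
      linarith
    have h2 := hdvd 2 (by norm_num) (by push_cast at hl ⊢; nlinarith)
    have h3 := hdvd 3 (by norm_num) (by push_cast at hl ⊢; nlinarith)
    exact (hco 7 26 (by norm_num) (by simpa using h2) (by simpa using h3)).elim
  have hc : cKP n = (n : ℝ) ^ 2 := by simp [cKP, h1]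
  rw [hc]
  by_contra hlt
  have hle : n ^ 2 ≤ ℓ := by
    have := not_lt.1 hlt
    exact_mod_cast this
  have hne : n ^ 2 ≠ ℓ := by
    intro h
    exact (Nat.Prime.not_prime_pow (x := n) (n := 2) le_rfl) (h ▸ hℓ)
  have hbad : KPbad n ℓ := by
    refine ⟨hn, hℓ, lt_of_le_of_ne hle hne, ?_⟩
    intro h hh1 hh2
    rcases eq_or_lt_of_le hh1 with h' | h'
    · subst h'; simp
    · have := (ZMod.intCast_zmod_eq_zero_iff_dvd _ ℓ).2 (hdvd h h' hh2)
      push_cast at this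
      exact sub_eq_zero.1 this
  have hbig := KP_chain n ℓ hbad (by omega)
  obtain ⟨k, z, hz1, hz2, hz3, hz4⟩ := KP_large n hbig
  obtain ⟨_, _, hlt', hh⟩ := hbad
  have := KP_prod n ℓ z k hn hℓ
    (fun h h1 h2 => hh h h1 (le_trans (by exact_mod_cast h2) hz2)) hz1 (lt_of_le_of_lt hz3 hlt')
  omega
end

section
/- Let n be a positive integer and ℓ a prime with ℓ > c(n), where c(n) = n² for n ≥ 2 and c(1) = 2. Then there exists a prime p ≤ b(n) (with b(n) = 4(log n)² for n ≥ 3, b(1) = 2, b(2) = 3) such that p^n ≢ 1 (mod ℓ). -/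
set_option exponentiation.threshold 2000

lemma kp_count (n : ℕ) (hn : 0 < n) (ℓ : ℕ) (hℓ : ℓ.Prime) (P : Finset ℕ) (B u : ℕ)
    (hP : ∀ p ∈ P, p.Prime ∧ p ≤ B) (hB : 1 ≤ B) (hBu : B ^ u < ℓ)
    (h : ∀ p ∈ P, ((p : ZMod ℓ)) ^ n = 1) : (P.card + u).choose u ≤ n := by
  classical
  have : Fact ℓ.Prime := ⟨hℓ⟩
  have h1P : 1 ∉ P := fun h1 => Nat.not_prime_one (hP 1 h1).1
  have hcard : (P.card + u).choose u ≤ ((insert 1 P).sym u).card := by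
    have i0 : Fintype (Sym {x // x ∈ insert 1 P} u) := Fintype.ofFinite _
    have e : Fintype.card (Sym {x // x ∈ insert 1 P} u) = (P.card + u).choose u := by
      rw [Sym.card_sym_eq_multichoose, Fintype.card_coe, Finset.card_insert_of_notMem h1P,
        Nat.multichoose_eq]
      congr 1
      omega
    rw [← e, ← Finset.card_univ]
    refine Finset.card_le_card_of_injOn (Sym.map Subtype.val) ?_ ?_
    · intro m _
      simp only [Finset.mem_coe, Finset.mem_sym_iff, Sym.mem_map]
      rintro a ⟨b, _, rfl⟩
      exact b.2
    · exact (Sym.map_injective Subtype.val_injective u).injOn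
  refine le_trans hcard ?_
  have hroots : (Polynomial.nthRootsFinset n (1 : ZMod ℓ)).card ≤ n := by
    rw [Polynomial.nthRootsFinset_def]
    exact (Multiset.toFinset_card_le _).trans (Polynomial.card_nthRoots n 1)
  refine le_trans ?_ hroots
  have hQ : ∀ p ∈ insert 1 P, 1 ≤ p ∧ p ≤ B ∧ (p : ZMod ℓ) ^ n = 1 := by
    intro p hp
    rcases Finset.mem_insert.1 hp with rfl | hp
    · simp [hB]
    · exact ⟨(hP p hp).1.one_lt.le, (hP p hp).2, h p hp⟩
  have hlt : ∀ m ∈ (insert 1 P).sym u, (m : Multiset ℕ).prod < ℓ := by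
    intro m hm
    rw [Finset.mem_sym_iff] at hm
    refine lt_of_le_of_lt ?_ hBu
    have := Multiset.prod_le_pow_card (m : Multiset ℕ) B (fun x hx => (hQ x (hm x hx)).2.1)
    simpa using this
  refine Finset.card_le_card_of_injOn (fun m => (((m : Multiset ℕ).prod : ℕ) : ZMod ℓ)) ?_ ?_
  · intro m hm
    have hm' := Finset.mem_sym_iff.1 hm
    simp only [Finset.mem_coe]
    rw [Polynomial.mem_nthRootsFinset hn]
    rw [Nat.cast_multiset_prod, ← Multiset.prod_map_pow]
    apply Multiset.prod_eq_one
    intro x hx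
    simp only [Multiset.mem_map] at hx
    obtain ⟨b, hb, rfl⟩ := hx
    exact (hQ b (hm' b hb)).2.2
  · intro m hm m' hm' heq
    simp only at heq
    rw [ZMod.natCast_eq_natCast_iff] at heq
    have heq := Nat.ModEq.eq_of_lt_of_lt heq (hlt m hm) (hlt m' hm')
    have key : ∀ s ∈ (insert 1 P).sym u, (s : Multiset ℕ) =
        Multiset.replicate (u - ((s : Multiset ℕ).prod.primeFactorsList : Multiset ℕ).card) 1
         + ((s : Multiset ℕ).prod.primeFactorsList : Multiset ℕ) := by
      intro s hs
      have hs' := Finset.mem_sym_iff.1 hs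
      set M : Multiset ℕ := (s : Multiset ℕ) with hM
      have hMc : M.card = u := s.2
      have e := Multiset.filter_add_not (fun x => x = 1) M
      have e1 : M.filter (fun x => x = 1) = Multiset.replicate (M.count 1) 1 :=
        Multiset.filter_eq' M 1
      have e2 : (M.filter (fun x => ¬ x = 1)).prod = M.prod := by
        conv_rhs => rw [← e, Multiset.prod_add, e1]
        simp
      have e3 : (M.prod.primeFactorsList : Multiset ℕ) = M.filter (fun x => ¬ x = 1) := by
        rw [← e2]
        set F := M.filter (fun x => ¬ x = 1) with hF
        have hp : ∀ p ∈ F, p.Prime := by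
          intro p hp
          rw [hF, Multiset.mem_filter] at hp
          have := hs' p hp.1
          rcases Finset.mem_insert.1 this with h | h
          · exact absurd h hp.2
          · exact (hP p h).1
        have hperm : F.toList.Perm (F.prod.primeFactorsList) := by
          apply Nat.primeFactorsList_unique
          · simp
          · intro p hpp; exact hp p (by simpa using hpp)
        rw [← Multiset.coe_eq_coe.2 hperm, Multiset.coe_toList]
      rw [e3]
      conv_lhs => rw [← e, e1]
      congr 2
      have := congrArg Multiset.card e
      rw [Multiset.card_add, e1, Multiset.card_replicate] at this
      omega
    apply Sym.coe_injective
    rw [key m hm, key m' hm', heq]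

lemma kp_key (n : ℕ) (hn : 3 ≤ n) (ℓ : ℕ) (hℓ : ℓ.Prime) (B u t : ℕ)
    (hB1 : 1 ≤ B) (hB : (B : ℝ) ≤ 4 * (Real.log n) ^ 2) (hBu : B ^ u < ℓ)
    (ht : t ≤ Nat.primeCounting B) (hc : n < (t + u).choose u) :
    ∃ p : ℕ, p.Prime ∧ (p : ℝ) ≤ bKP n ∧ ¬ (ℓ : ℤ) ∣ (p : ℤ) ^ n - 1 := by
  by_contra! hcon
  have hb : bKP n = 4 * (Real.log n) ^ 2 := by
    unfold bKP
    rw [if_neg (by omega), if_neg (by omega)]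
  have := kp_count n (by omega) ℓ hℓ (Nat.primesLE B) B u ?_ hB1 hBu ?_
  · rw [Nat.primesLE_card_eq_primeCounting] at this
    have h2 : (t + u).choose u ≤ (Nat.primeCounting B + u).choose u :=
      Nat.choose_le_choose _ (by omega)
    omega
  · intro p hp
    exact ⟨Nat.prime_of_mem_primesLE hp, Nat.le_of_mem_primesLE hp⟩
  · intro p hp
    have hpB : p ≤ B := Nat.le_of_mem_primesLE hp
    have := hcon p (Nat.prime_of_mem_primesLE hp) (by
      rw [hb]; refine le_trans ?_ hB; exact_mod_cast hpB)
    have := (ZMod.intCast_zmod_eq_zero_iff_dvd _ ℓ).2 this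
    push_cast at this
    exact sub_eq_zero.1 this

def kpTrial : List ℕ := [2,3,5,7,11,13,17,19,23,29,31,37,41,43,47,53,59,61,67,71,73,79,83,89,97,
  101,103,107,109,113,127,131]

def kpCheck (m : ℕ) (l : List ℕ) : Bool :=
  List.rec false (fun q _ ih => cond (Nat.blt m (Nat.mul q q)) true
    (cond (Nat.beq (Nat.mod m q) 0) false ih)) l

def kpCnt (f : ℕ) : ℕ → ℕ → ℕ :=
  Nat.rec (fun _ _ => 0) (fun _ ih lo len =>
    cond (Nat.beq len 0) 0 (cond (Nat.beq len 1) (cond (kpCheck lo kpTrial) 1 0)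
    (Nat.add (ih lo (Nat.div len 2)) (ih (Nat.add lo (Nat.div len 2)) (Nat.sub len (Nat.div len 2)))))) f

lemma kpCheck_false (m p : ℕ) (h1 : p ∣ m) (h2 : p * p ≤ m) : ∀ l : List ℕ, l.Pairwise (· ≤ ·) →
    p ∈ l → kpCheck m l = false := by
  intro l
  induction l with
  | nil => simp
  | cons q l ih =>
    intro hs hp
    have e : kpCheck m (q :: l) = cond (Nat.blt m (Nat.mul q q)) true
      (cond (Nat.beq (Nat.mod m q) 0) false (kpCheck m l)) := rfl
    rw [List.pairwise_cons] at hs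
    have hqp : q ≤ p := by
      rcases List.mem_cons.1 hp with rfl | h
      · exact le_rfl
      · exact hs.1 _ h
    have hb : Nat.blt m (Nat.mul q q) = false := by
      rw [Bool.eq_false_iff]
      intro h
      rw [Nat.blt_eq] at h
      have : Nat.mul q q = q * q := rfl
      have := Nat.mul_le_mul hqp hqp
      omega
    rw [e, hb]
    rcases List.mem_cons.1 hp with rfl | h
    · have : Nat.mod m p = 0 := Nat.mod_eq_zero_of_dvd h1
      simp [this]
    · rw [ih hs.2 h]; simp

lemma kpCheck_prime (m : ℕ) (hm : 2 ≤ m) (hm2 : m < 17000) (h : kpCheck m kpTrial = true) :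
    m.Prime := by
  by_contra hnp
  have hp := Nat.minFac_prime (n := m) (by omega)
  have hsq := Nat.minFac_sq_le_self (n := m) (by omega) hnp
  have hlt : m.minFac < 131 := by nlinarith
  have hmem : ∀ p < 131, p.Prime → p ∈ kpTrial := by
    intro p hp hpp
    unfold kpTrial
    interval_cases p <;> first | (simp; done) | (exfalso; revert hpp; norm_num)
  have := kpCheck_false m m.minFac (Nat.minFac_dvd m) (by nlinarith) kpTrial (by decide)
    (hmem _ hlt hp)
  simp [this] at h

lemma kpCnt_le (f : ℕ) : ∀ lo len : ℕ, 2 ≤ lo → lo + len ≤ 17000 →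
    kpCnt f lo len ≤ ((Finset.Ico lo (lo + len)).filter Nat.Prime).card := by
  induction f with
  | zero => intro lo len _ _; exact Nat.zero_le _
  | succ f ih =>
    intro lo len h2 h3
    have e : kpCnt (f + 1) lo len = cond (Nat.beq len 0) 0 (cond (Nat.beq len 1)
      (cond (kpCheck lo kpTrial) 1 0)
      ((kpCnt f lo (len / 2)) + (kpCnt f (lo + len / 2) (len - len / 2)))) := rfl
    rw [e]
    rcases Nat.eq_zero_or_pos len with rfl | hl
    · simp
    rcases eq_or_ne len 1 with rfl | hl1
    · simp only [Nat.beq]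
      cases hk : kpCheck lo kpTrial
      · simp
      · have := kpCheck_prime lo h2 (by omega) hk
        simp [Finset.filter_singleton, this]
    · have b0 : Nat.beq len 0 = false := by
        rw [Bool.eq_false_iff]; intro h; have := Nat.eq_of_beq_eq_true h; omega
      have b1 : Nat.beq len 1 = false := by
        rw [Bool.eq_false_iff]; intro h; have := Nat.eq_of_beq_eq_true h; omega
      rw [b0, b1]
      simp only [cond_false]
      have i1 := ih lo (len / 2) h2 (by omega)
      have i2 := ih (lo + len / 2) (len - len / 2) (by omega) (by omega)
      have e2 : lo + len / 2 + (len - len / 2) = lo + len := by omega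
      rw [e2] at i2
      rw [← Finset.Ico_union_Ico_eq_Ico (a := lo) (b := lo + len / 2) (c := lo + len) (by omega)
        (by omega), Finset.filter_union, Finset.card_union_of_disjoint]
      · omega
      · apply Finset.disjoint_filter_filter
        exact Finset.Ico_disjoint_Ico_consecutive _ _ _

lemma kp_pi (B t : ℕ) (h1 : 2 ≤ B) (h2 : B < 17000) (h : Nat.ble t (kpCnt 16 2 (B - 1)) = true) :
    t ≤ Nat.primeCounting B := by
  have := kpCnt_le 16 2 (B - 1) le_rfl (by omega)
  refine (Nat.le_of_ble_eq_true h).trans (this.trans ?_)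
  rw [← Nat.primesLE_card_eq_primeCounting]
  apply Finset.card_le_card
  intro p hp
  simp only [Finset.mem_filter, Finset.mem_Ico] at hp
  rw [Nat.mem_primesLE]
  exact ⟨by omega, hp.2⟩


lemma kp_choose (N t u : ℕ)
    (h : Nat.ble (N * u.factorial) ((t + 1).ascFactorial u) = true) : N ≤ (t + u).choose u := by
  have h := Nat.le_of_ble_eq_true h
  rw [Nat.ascFactorial_eq_factorial_mul_choose, mul_comm] at h
  exact le_of_mul_le_mul_left h (Nat.factorial_pos u)

lemma kp_row (n ℓ : ℕ) (hℓ : ℓ.Prime) (hc : n ^ 2 < ℓ) (N B u t a b : ℕ) (hN : N ≤ n)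
    (h3 : 3 ≤ N) (hb : 0 < b) (hlog : 27183 ^ a ≤ N ^ b * 10000 ^ a)
    (hB : B * b ^ 2 ≤ 4 * a ^ 2) (hB1 : 1 ≤ B) (hBu : B ^ u ≤ N ^ 2)
    (ht : t ≤ Nat.primeCounting B) (hch : n < (t + u).choose u) :
    ∃ p : ℕ, p.Prime ∧ (p : ℝ) ≤ bKP n ∧ ¬ (ℓ : ℤ) ∣ (p : ℤ) ^ n - 1 := by
  have hN0 : (0 : ℝ) < N := by
    have : 0 < N := by omega
    exact_mod_cast this
  have hNn : Real.log N ≤ Real.log n := Real.log_le_log hN0 (by exact_mod_cast hN)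
  have hb0 : (0 : ℝ) < b := by exact_mod_cast hb
  have hl : (a : ℝ) ≤ b * Real.log N := by
    rw [← Real.log_pow, Real.le_log_iff_exp_le (by positivity)]
    have h1 : Real.exp a = Real.exp 1 ^ a := by rw [← Real.exp_nat_mul]; simp
    have h2 : Real.exp 1 ^ a ≤ (27183 / 10000 : ℝ) ^ a :=
      pow_le_pow_left₀ (Real.exp_pos 1).le (by linarith [Real.exp_one_lt_d9]) _
    rw [h1]
    refine h2.trans ?_
    rw [div_pow, div_le_iff₀ (by positivity)]
    exact_mod_cast hlog
  have hl' : (a : ℝ) ≤ b * Real.log n := hl.trans (by gcongr)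
  refine kp_key n (by omega) ℓ hℓ B u t hB1 ?_ ?_ ht hch
  · have h1 : (B : ℝ) * b ^ 2 ≤ 4 * a ^ 2 := by exact_mod_cast hB
    have h2 : (a : ℝ) ^ 2 ≤ (b * Real.log n) ^ 2 := by gcongr
    have h3 : (B : ℝ) * b ^ 2 ≤ (4 * Real.log n ^ 2) * b ^ 2 := by nlinarith
    exact le_of_mul_le_mul_right h3 (by positivity)
  · have : N ^ 2 ≤ n ^ 2 := Nat.pow_le_pow_left hN 2
    omega

lemma kp_asymp (n ℓ : ℕ) (hn : 10 ^ 33 ≤ n) (hc : n ^ 2 < ℓ) :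
    ∃ B u t : ℕ, 1 ≤ B ∧ (B : ℝ) ≤ 4 * (Real.log n) ^ 2 ∧ B ^ u < ℓ ∧
      t ≤ Nat.primeCounting B ∧ n < (t + u).choose u := by
  have hn0 : (0 : ℝ) < n := by
    have : 0 < n := lt_of_lt_of_le (by norm_num) hn
    exact_mod_cast this
  have hlog : 75 ≤ Real.log n := by
    rw [Real.le_log_iff_exp_le hn0]
    have h1 : Real.exp 75 = Real.exp 1 ^ 75 := by rw [← Real.exp_nat_mul]; norm_num
    rw [h1]
    have h2 : Real.exp 1 ^ 75 ≤ (2.7183 : ℝ) ^ 75 :=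
      pow_le_pow_left₀ (Real.exp_pos 1).le (by linarith [Real.exp_one_lt_d9]) _
    have h3 : ((10 : ℝ) ^ 33) ≤ n := by exact_mod_cast hn
    refine h2.trans (le_trans ?_ h3)
    norm_num
  obtain ⟨L, hL⟩ : ∃ L, L = 2 * Real.log n := ⟨_, rfl⟩
  have hL150 : 150 ≤ L := by linarith
  have hL0 : 0 < L := by linarith
  obtain ⟨w, hw⟩ : ∃ w, w = Real.log L := ⟨_, rfl⟩
  have hexpw : Real.exp w = L := by rw [hw, Real.exp_log hL0]
  have he5 : Real.exp 5 ≤ 150 := by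
    have h1 : Real.exp 5 = Real.exp 1 ^ 5 := by rw [← Real.exp_nat_mul]; norm_num
    rw [h1]
    have h2 : Real.exp 1 ^ 5 ≤ (2.7183 : ℝ) ^ 5 :=
      pow_le_pow_left₀ (Real.exp_pos 1).le (by linarith [Real.exp_one_lt_d9]) _
    refine h2.trans ?_
    norm_num
  have he5' : 148 ≤ Real.exp 5 := by
    have h1 : Real.exp 5 = Real.exp 1 ^ 5 := by rw [← Real.exp_nat_mul]; norm_num
    rw [h1]
    have h2 : (2.718 : ℝ) ^ 5 ≤ Real.exp 1 ^ 5 :=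
      pow_le_pow_left₀ (by norm_num) (by linarith [Real.exp_one_gt_d9]) _
    refine le_trans ?_ h2
    norm_num
  have hw5 : 5 ≤ w := by
    rw [hw, Real.le_log_iff_exp_le hL0]; linarith
  have hw0 : 0 < w := by linarith
  obtain ⟨v, hv⟩ : ∃ v, v = L / (2 * w) := ⟨_, rfl⟩
  have hvw : 2 * w * v = L := by rw [hv]; field_simp
  have hLw : 5 * w ^ 2 + 2 * w < L := by
    have h1 : Real.exp w = Real.exp 5 * Real.exp (w - 5) := by
      rw [← Real.exp_add]; congr 1; ring
    have h2 := Real.quadratic_le_exp_of_nonneg (x := w - 5) (by linarith)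
    have h3 : 148 * (1 + (w - 5) + (w - 5) ^ 2 / 2) ≤ Real.exp w := by
      rw [h1]
      apply mul_le_mul he5' h2 _ (Real.exp_pos 5).le
      nlinarith
    rw [← hexpw]
    nlinarith
  have hv1 : 1.5 * w + 0.6 < 0.6 * v := by
    by_contra! h
    have : 2 * w * (0.6 * v) ≤ 2 * w * (1.5 * w + 0.6) := by gcongr
    nlinarith
  have hv0 : 1 ≤ v := by linarith
  have hlogv : Real.log v ≤ w - 2 := by
    have h1 : w = Real.log (2 * w) + Real.log v := by
      rw [← Real.log_mul (by positivity) (by positivity), hvw, hw]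
    have h2 : 2 ≤ Real.log (2 * w) := by
      rw [Real.le_log_iff_exp_le (by positivity)]
      have h1 : Real.exp 2 = Real.exp 1 ^ 2 := by rw [← Real.exp_nat_mul]; norm_num
      rw [h1]
      nlinarith [Real.exp_one_lt_d9, Real.exp_pos 1]
    linarith
  have hy : 4 * (Real.log n) ^ 2 = L ^ 2 := by rw [hL]; ring
  obtain ⟨B, hB⟩ : ∃ B, B = ⌊L ^ 2⌋₊ := ⟨_, rfl⟩
  obtain ⟨u, hu⟩ : ∃ u, u = ⌊v⌋₊ := ⟨_, rfl⟩
  have hBle : (B : ℝ) ≤ L ^ 2 := by rw [hB]; exact Nat.floor_le (by positivity)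
  have hule : (u : ℝ) ≤ v := by rw [hu]; exact Nat.floor_le (by positivity)
  have hult : v - 1 < u := by rw [hu]; exact Nat.sub_one_lt_floor v
  have hu1 : 1 ≤ u := by rw [hu]; exact Nat.le_floor (by exact_mod_cast hv0)
  have hu0 : (0 : ℝ) < u := by exact_mod_cast hu1
  refine ⟨B, u, Nat.primeCounting B, ?_, by rw [hy]; exact hBle, ?_, le_rfl, ?_⟩
  · rw [hB]; apply Nat.le_floor; push_cast; nlinarith
  · refine lt_of_le_of_lt ?_ hc
    have h1 : (B : ℝ) ^ u ≤ (n : ℝ) ^ 2 := by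
      calc (B : ℝ) ^ u ≤ (L ^ 2) ^ u := by gcongr
        _ = Real.exp (u * (2 * w)) := by
          rw [Real.exp_nat_mul, ← hexpw, ← Real.exp_nat_mul]; norm_num
        _ ≤ Real.exp L := by
          apply Real.exp_le_exp.2
          nlinarith
        _ = (n : ℝ) ^ 2 := by
          rw [hL, show (2 : ℝ) * Real.log n = ((2 : ℕ) : ℝ) * Real.log n by norm_num,
            Real.exp_nat_mul, Real.exp_log hn0]
    exact_mod_cast h1
  · obtain ⟨k, hk⟩ : ∃ k, k = Nat.primeCounting B := ⟨_, rfl⟩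
    rw [← hk]
    have hlogy : Real.log (L ^ 2) = 2 * w := by rw [Real.log_pow, hw]; norm_num
    have hpi : (k : ℝ) * (2 * w) ≥ (L ^ 2 - 1) * Real.log 2 - Real.log (L ^ 2 + 2) := by
      have h1 := Chebyshev.psi_ge' (x := L ^ 2) (by positivity)
      have h2 := Chebyshev.psi_le_primeCounting_mul_log' (L ^ 2)
      rw [hlogy, ← hB, ← hk] at h2
      linarith
    have hl2 : Real.log (L ^ 2 + 2) ≤ Real.log 2 + 2 * w := by
      rw [← hlogy, ← Real.log_mul (by norm_num) (by positivity)]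
      apply Real.log_le_log (by positivity)
      nlinarith
    have hk1 : 0.69 * L * v ≤ k + 1 := by
      have h3 : (2 * w) * (0.69 * L * v) ≤ (2 * w) * (k + 1) := by
        have : (2 * w) * (0.69 * L * v) = 0.69 * L ^ 2 := by
          rw [show (2 * w) * (0.69 * L * v) = 0.69 * L * (2 * w * v) by ring, hvw]; ring
        rw [this]
        nlinarith [Real.log_two_gt_d9, Real.log_two_lt_d9]
      exact le_of_mul_le_mul_left h3 (by positivity)
    have hlogk : -0.4 + w + Real.log v ≤ Real.log (k + 1) := by
      have h69 : -0.4 ≤ Real.log 0.69 := by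
        rw [Real.le_log_iff_exp_le (by norm_num)]
        have h1 : Real.exp (-0.4) ^ 5 = (Real.exp 1 ^ 2)⁻¹ := by
          rw [← Real.exp_nat_mul, ← Real.exp_nat_mul, ← Real.exp_neg]; norm_num
        have h2 : (2.718 : ℝ) ^ 2 ≤ Real.exp 1 ^ 2 :=
          pow_le_pow_left₀ (by norm_num) (by linarith [Real.exp_one_gt_d9]) _
        have h3 : (Real.exp 1 ^ 2)⁻¹ ≤ ((2.718 : ℝ) ^ 2)⁻¹ := by gcongr
        refine le_of_pow_le_pow_left₀ (n := 5) (by norm_num) (by norm_num) ?_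
        rw [h1]
        refine h3.trans ?_
        norm_num
      have h1 := Real.log_le_log (by positivity) hk1
      rw [Real.log_mul (by positivity) (by positivity),
        Real.log_mul (by positivity) (by positivity), ← hw] at h1
      linarith
    have hfac : Real.log (u.factorial) ≤ 1 + Real.log u / 2 + u * Real.log u - u := by
      have h1 := Stirling.log_stirlingSeq_formula u
      have h2 : Real.log (Stirling.stirlingSeq u) ≤ Real.log (Stirling.stirlingSeq 1) := by
        have := Stirling.log_stirlingSeq'_antitone (Nat.zero_le (u - 1))
        simp only [Function.comp] at this
        rwa [show Nat.succ (u - 1) = u by omega] at this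
      have h3 := Stirling.log_stirlingSeq_formula 1
      rw [Real.log_mul (by norm_num) hu0.ne', Real.log_div hu0.ne' (Real.exp_pos 1).ne',
        Real.log_exp] at h1
      simp at h3
      rw [Stirling.stirlingSeq_one] at h2
      linarith
    have hch : (k + 1) ^ u ≤ u.factorial * (k + u).choose u := by
      rw [← Nat.ascFactorial_eq_factorial_mul_choose]
      exact Nat.pow_succ_le_ascFactorial _ _
    have hcpos : 0 < (k + u).choose u := Nat.choose_pos (by omega)
    have hch' : u * Real.log (k + 1) ≤
        Real.log u.factorial + Real.log ((k + u).choose u) := by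
      have h1 : ((k : ℝ) + 1) ^ u ≤ (u.factorial : ℝ) * ((k + u).choose u : ℝ) := by
        exact_mod_cast hch
      have h2 := Real.log_le_log (by positivity) h1
      rwa [Real.log_pow, Real.log_mul (by positivity) (by positivity)] at h2
    have hluv : Real.log u ≤ Real.log v := Real.log_le_log hu0 hule
    have hmain : Real.log n < Real.log ((k + u).choose u) := by
      have a1 : u * (-0.4 + w + Real.log v) ≤ u * Real.log (k + 1) := by gcongr
      have a2 : u * Real.log u ≤ u * Real.log v := by gcongr
      have a3 : (v - 1) * (w + 0.6) ≤ u * (w + 0.6) := by gcongr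
      have a4 : Real.log n = v * w := by linarith
      linarith
    have := (Real.log_lt_log_iff hn0 (by exact_mod_cast hcpos)).1 hmain
    exact_mod_cast this

/-- For every prime `ℓ > c(n)` there is a prime `p ≤ b(n)` with `p^n ≢ 1 (mod ℓ)`. -/
theorem stmt12 (n : ℕ) (hn : 0 < n) (ℓ : ℕ) (hℓ : ℓ.Prime) (hc : cKP n < ℓ) :
    ∃ p : ℕ, p.Prime ∧ (p : ℝ) ≤ bKP n ∧ ¬ (ℓ : ℤ) ∣ (p : ℤ) ^ n - 1 := by
  rcases eq_or_ne n 1 with rfl | h1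
  · refine ⟨2, Nat.prime_two, by simp [bKP], ?_⟩
    intro h
    have h' : (ℓ : ℤ) ∣ 1 := by simpa using h
    have h2 : ℓ ∣ 1 := by exact_mod_cast h'
    exact hℓ.one_lt.ne' (Nat.dvd_one.1 h2)
  have hc : n ^ 2 < ℓ := by
    unfold cKP at hc
    rw [if_neg h1] at hc
    exact_mod_cast hc
  rcases eq_or_ne n 2 with rfl | h2
  · refine ⟨2, Nat.prime_two, by norm_num [bKP], ?_⟩
    intro h
    have h' : (ℓ : ℤ) ∣ ((3 : ℕ) : ℤ) := by norm_num at h; exact_mod_cast h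
    have h2 : ℓ ∣ 3 := by exact_mod_cast h'
    have := Nat.le_of_dvd (by norm_num) h2
    omega
  have hn3 : 3 ≤ n := by omega
  rcases lt_or_ge n 6 with h | h
  · exact kp_row n ℓ hℓ hc 3 3 2 2 10 10 (by assumption) (by norm_num) (by norm_num) (by norm_num) (by norm_num)
      (by norm_num) (by norm_num) (kp_pi _ _ (by norm_num) (by norm_num) (by decide +kernel)) (lt_of_lt_of_le h <| kp_choose _ _ _ (by decide +kernel))
  rcases lt_or_ge n 10 with h | h
  · exact kp_row n ℓ hℓ hc 6 5 2 3 17 10 (by assumption) (by norm_num) (by norm_num) (by norm_num) (by norm_num)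
      (by norm_num) (by norm_num) (kp_pi _ _ (by norm_num) (by norm_num) (by decide +kernel)) (lt_of_lt_of_le h <| kp_choose _ _ _ (by decide +kernel))
  rcases lt_or_ge n 15 with h | h
  · exact kp_row n ℓ hℓ hc 10 7 2 4 23 10 (by assumption) (by norm_num) (by norm_num) (by norm_num) (by norm_num)
      (by norm_num) (by norm_num) (kp_pi _ _ (by norm_num) (by norm_num) (by decide +kernel)) (lt_of_lt_of_le h <| kp_choose _ _ _ (by decide +kernel))
  rcases lt_or_ge n 28 with h | h
  · exact kp_row n ℓ hℓ hc 15 13 2 6 27 10 (by assumption) (by norm_num) (by norm_num) (by norm_num) (by norm_num)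
      (by norm_num) (by norm_num) (kp_pi _ _ (by norm_num) (by norm_num) (by decide +kernel)) (lt_of_lt_of_le h <| kp_choose _ _ _ (by decide +kernel))
  rcases lt_or_ge n 55 with h | h
  · exact kp_row n ℓ hℓ hc 28 23 2 9 33 10 (by assumption) (by norm_num) (by norm_num) (by norm_num) (by norm_num)
      (by norm_num) (by norm_num) (kp_pi _ _ (by norm_num) (by norm_num) (by decide +kernel)) (lt_of_lt_of_le h <| kp_choose _ _ _ (by decide +kernel))
  rcases lt_or_ge n 153 with h | h
  · exact kp_row n ℓ hℓ hc 55 53 2 16 40 10 (by assumption) (by norm_num) (by norm_num) (by norm_num) (by norm_num)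
      (by norm_num) (by norm_num) (kp_pi _ _ (by norm_num) (by norm_num) (by decide +kernel)) (lt_of_lt_of_le h <| kp_choose _ _ _ (by decide +kernel))
  rcases lt_or_ge n 351 with h | h
  · exact kp_row n ℓ hℓ hc 153 97 2 25 50 10 (by assumption) (by norm_num) (by norm_num) (by norm_num) (by norm_num)
      (by norm_num) (by norm_num) (kp_pi _ _ (by norm_num) (by norm_num) (by decide +kernel)) (lt_of_lt_of_le h <| kp_choose _ _ _ (by decide +kernel))
  rcases lt_or_ge n 816 with h | h
  · exact kp_row n ℓ hℓ hc 351 47 3 15 58 10 (by assumption) (by norm_num) (by norm_num) (by norm_num) (by norm_num)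
      (by norm_num) (by norm_num) (kp_pi _ _ (by norm_num) (by norm_num) (by decide +kernel)) (lt_of_lt_of_le h <| kp_choose _ _ _ (by decide +kernel))
  rcases lt_or_ge n 2600 with h | h
  · exact kp_row n ℓ hℓ hc 816 83 3 23 67 10 (by assumption) (by norm_num) (by norm_num) (by norm_num) (by norm_num)
      (by norm_num) (by norm_num) (kp_pi _ _ (by norm_num) (by norm_num) (by decide +kernel)) (lt_of_lt_of_le h <| kp_choose _ _ _ (by decide +kernel))
  rcases lt_or_ge n 14190 with h | h
  · exact kp_row n ℓ hℓ hc 2600 181 3 42 78 10 (by assumption) (by norm_num) (by norm_num) (by norm_num) (by norm_num)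
      (by norm_num) (by norm_num) (kp_pi _ _ (by norm_num) (by norm_num) (by decide +kernel)) (lt_of_lt_of_le h <| kp_choose _ _ _ (by decide +kernel))
  rcases lt_or_ge n 67525 with h | h
  · exact kp_row n ℓ hℓ hc 14190 359 3 72 95 10 (by assumption) (by norm_num) (by norm_num) (by norm_num) (by norm_num)
      (by norm_num) (by norm_num) (kp_pi _ _ (by norm_num) (by norm_num) (by decide +kernel)) (lt_of_lt_of_le h <| kp_choose _ _ _ (by decide +kernel))
  rcases lt_or_ge n 455126 with h | h
  · exact kp_row n ℓ hℓ hc 67525 257 4 55 111 10 (by assumption) (by norm_num) (by norm_num) (by norm_num) (by norm_num)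
      (by norm_num) (by norm_num) (kp_pi _ _ (by norm_num) (by norm_num) (by decide +kernel)) (lt_of_lt_of_le h <| kp_choose _ _ _ (by decide +kernel))
  rcases lt_or_ge n 10009125 with h | h
  · exact kp_row n ℓ hℓ hc 455126 673 4 122 130 10 (by assumption) (by norm_num) (by norm_num) (by norm_num) (by norm_num)
      (by norm_num) (by norm_num) (kp_pi _ _ (by norm_num) (by norm_num) (by decide +kernel)) (lt_of_lt_of_le h <| kp_choose _ _ _ (by decide +kernel))
  rcases lt_or_ge n 190578024 with h | h
  · exact kp_row n ℓ hℓ hc 10009125 631 5 115 161 10 (by assumption) (by norm_num) (by norm_num) (by norm_num) (by norm_num)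
      (by norm_num) (by norm_num) (kp_pi _ _ (by norm_num) (by norm_num) (by decide +kernel)) (lt_of_lt_of_le h <| kp_choose _ _ _ (by decide +kernel))
  rcases lt_or_ge n 5480724326 with h | h
  · exact kp_row n ℓ hℓ hc 190578024 1439 5 228 190 10 (by assumption) (by norm_num) (by norm_num) (by norm_num) (by norm_num)
      (by norm_num) (by norm_num) (kp_pi _ _ (by norm_num) (by norm_num) (by decide +kernel)) (lt_of_lt_of_le h <| kp_choose _ _ _ (by decide +kernel))
  rcases lt_or_ge n 634155960900 with h | h
  · exact kp_row n ℓ hℓ hc 5480724326 1759 6 274 224 10 (by assumption) (by norm_num) (by norm_num) (by norm_num) (by norm_num)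
      (by norm_num) (by norm_num) (kp_pi _ _ (by norm_num) (by norm_num) (by decide +kernel)) (lt_of_lt_of_le h <| kp_choose _ _ _ (by decide +kernel))
  rcases lt_or_ge n 135501345064800 with h | h
  · exact kp_row n ℓ hℓ hc 634155960900 2351 7 349 271 10 (by assumption) (by norm_num) (by norm_num) (by norm_num) (by norm_num)
      (by norm_num) (by norm_num) (kp_pi _ _ (by norm_num) (by norm_num) (by decide +kernel)) (lt_of_lt_of_le h <| kp_choose _ _ _ (by decide +kernel))
  rcases lt_or_ge n 74064874286480220 with h | h
  · exact kp_row n ℓ hℓ hc 135501345064800 3407 8 479 325 10 (by assumption) (by norm_num) (by norm_num) (by norm_num) (by norm_num)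
      (by norm_num) (by norm_num) (kp_pi _ _ (by norm_num) (by norm_num) (by decide +kernel)) (lt_of_lt_of_le h <| kp_choose _ _ _ (by decide +kernel))
  rcases lt_or_ge n 190157163185878304195 with h | h
  · exact kp_row n ℓ hℓ hc 74064874286480220 5591 9 738 388 10 (by assumption) (by norm_num) (by norm_num) (by norm_num) (by norm_num)
      (by norm_num) (by norm_num) (kp_pi _ _ (by norm_num) (by norm_num) (by decide +kernel)) (lt_of_lt_of_le h <| kp_choose _ _ _ (by decide +kernel))
  rcases lt_or_ge n 631711957907789958398408 with h | h
  · exact kp_row n ℓ hℓ hc 190157163185878304195 8681 10 1081 466 10 (by assumption) (by norm_num) (by norm_num) (by norm_num) (by norm_num)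
      (by norm_num) (by norm_num) (kp_pi _ _ (by norm_num) (by norm_num) (by decide +kernel)) (lt_of_lt_of_le h <| kp_choose _ _ _ (by decide +kernel))
  rcases lt_or_ge n 11583795568651831028040649840 with h | h
  · exact kp_row n ℓ hℓ hc 631711957907789958398408 9257 12 1147 548 10 (by assumption) (by norm_num) (by norm_num) (by norm_num) (by norm_num)
      (by norm_num) (by norm_num) (kp_pi _ _ (by norm_num) (by norm_num) (by decide +kernel)) (lt_of_lt_of_le h <| kp_choose _ _ _ (by decide +kernel))
  rcases lt_or_ge n 867749195241835888325903409730418 with h | h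
  · exact kp_row n ℓ hℓ hc 11583795568651831028040649840 16691 13 1930 646 10 (by assumption) (by norm_num) (by norm_num) (by norm_num) (by norm_num)
      (by norm_num) (by norm_num) (kp_pi _ _ (by norm_num) (by norm_num) (by decide +kernel)) (lt_of_lt_of_le h <| kp_choose _ _ _ (by decide +kernel))
  rcases lt_or_ge n 1000000000000000000000000000000000 with h | h
  · exact kp_row n ℓ hℓ hc 867749195241835888325903409730418 13099 16 1558 758 10 (by assumption) (by norm_num) (by norm_num) (by norm_num) (by norm_num)
      (by norm_num) (by norm_num) (kp_pi _ _ (by norm_num) (by norm_num) (by decide +kernel)) (lt_of_lt_of_le h <| kp_choose _ _ _ (by decide +kernel))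
  obtain ⟨B, u, t, g1, g2, g3, g4, g5⟩ := kp_asymp n ℓ (by norm_num; exact h) hc
  exact kp_key n hn3 ℓ hℓ B u t g1 g2 g3 g4 g5
end

section
/- Let A be an order of ℤ-rank n ≥ 1 and ℓ a prime with ℓ > n². Then there exists a maximal ideal 𝔭 of A containing a prime number p ≤ 4(1 + (log n)²) such that #(A/𝔭) ≢ 1 (mod ℓ). -/
theorem aux_modcard {A : Type*} [CommRing A] (ℓ p : ℕ)
    (h : ∀ I : Ideal A, I.IsMaximal → (p : A) ∈ I → Finite (A ⧸ I) → (Nat.card (A ⧸ I) : ZMod ℓ) = 1)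
    (M : Type*) [AddCommGroup M] [Module A M] (hM : IsFiniteLength A M)
    (hfin : Finite M) (hp : ∀ x : M, (p : A) • x = 0) : (Nat.card M : ZMod ℓ) = 1 := by
  induction hM with
  | of_subsingleton => simp [Nat.card_unique]
  | @of_simple_quotient M _ _ N hs hN ih =>
    rw [Submodule.card_eq_card_quotient_mul_card N, Nat.cast_mul,
      ih inferInstance (fun x => Subtype.ext (by simpa using hp x)), one_mul]
    obtain ⟨I, hI, ⟨e⟩⟩ := isSimpleModule_iff_quot_maximal.mp hs
    have hf : Finite (M ⧸ N) := Finite.of_surjective _ N.mkQ_surjective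
    rw [Nat.card_congr e.toEquiv]
    refine h I hI ?_ (Finite.of_equiv _ e.toEquiv)
    obtain ⟨y, hy⟩ := e.surjective (Ideal.Quotient.mk I 1)
    obtain ⟨x, rfl⟩ := N.mkQ_surjective y
    have h1 : (p : A) • e (N.mkQ x) = 0 := by
      rw [← map_smul, ← map_smul, hp, map_zero, map_zero]
    rw [hy] at h1
    rw [← Ideal.Quotient.eq_zero_iff_mem]
    rw [← h1, Algebra.smul_def]
    simp

theorem aux_alg (A : Type*) [CommRing A] [Module.Free ℤ A] [Module.Finite ℤ A]
    (ℓ p : ℕ) (hp : p.Prime) (h : ((p : ZMod ℓ)) ^ (Module.finrank ℤ A) ≠ 1) :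
    ∃ 𝔭 : Ideal A, 𝔭.IsMaximal ∧ Finite (A ⧸ 𝔭) ∧ (p : A) ∈ 𝔭 ∧
      ¬ (ℓ : ℤ) ∣ (Nat.card (A ⧸ 𝔭) : ℤ) - 1 := by
  by_contra hcon
  push Not at hcon
  apply h
  have : NeZero p := ⟨hp.ne_zero⟩
  let J : Ideal A := Ideal.span {(p : A)}
  have e : ModN A p ≃ (A ⧸ J) := by
    refine (QuotientAddGroup.quotientAddEquivOfEq (M := (LinearMap.range (LinearMap.lsmul ℤ A p)).toAddSubgroup)
      (N := Submodule.toAddSubgroup J) ?_).toEquiv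
    ext x
    simp only [Submodule.mem_toAddSubgroup, LinearMap.mem_range, J, Ideal.mem_span_singleton,
      LinearMap.lsmul_apply]
    constructor
    · rintro ⟨y, rfl⟩; exact ⟨y, by simp⟩
    · rintro ⟨y, rfl⟩; exact ⟨y, by simp⟩
  have hfin : Finite (A ⧸ J) := Finite.of_equiv _ e
  have hc := ModN.natCard_eq A p
  rw [Nat.card_congr e] at hc
  rw [← Nat.cast_pow, ← hc]
  refine aux_modcard ℓ p (A := A) ?_ (A ⧸ J) ?_ hfin ?_
  · intro I hI hpI hIf
    have := hcon I hI hIf hpI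
    rw [← ZMod.intCast_zmod_eq_zero_iff_dvd] at this
    push_cast at this
    exact sub_eq_zero.mp this
  · rw [isFiniteLength_iff_isNoetherian_isArtinian]
    exact ⟨inferInstance, inferInstance⟩
  · intro x
    obtain ⟨y, rfl⟩ := Ideal.Quotient.mk_surjective x
    rw [Algebra.smul_def]
    have : (algebraMap A (A ⧸ J)) (p : A) = 0 := by
      rw [Ideal.Quotient.algebraMap_eq, Ideal.Quotient.eq_zero_iff_mem]
      exact Ideal.mem_span_singleton_self _
    rw [this, zero_mul]

/-- smooth numbers up to n² number at most n -/
theorem aux_roots (n ℓ q : ℕ) (hn : 1 ≤ n) (hℓ : ℓ.Prime) (hgt : n ^ 2 < ℓ)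
    (h : ∀ p : ℕ, p.Prime → p ≤ q → (p : ZMod ℓ) ^ n = 1) (S : Finset ℕ)
    (hS : ∀ m ∈ S, m ≤ n ^ 2 ∧ m ≠ 0 ∧ ∀ p ∈ m.primeFactorsList, p ≤ q) : S.card ≤ n := by
  have : Fact ℓ.Prime := ⟨hℓ⟩
  have hpow : ∀ m ∈ S, (m : ZMod ℓ) ^ n = 1 := by
    intro m hm
    obtain ⟨-, h0, h1⟩ := hS m hm
    rw [← Nat.prod_primeFactorsList h0]
    have h2 : ∀ p ∈ m.primeFactorsList, (p : ZMod ℓ) ^ n = 1 :=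
      fun p hp => h p (Nat.prime_of_mem_primeFactorsList hp) (h1 p hp)
    generalize m.primeFactorsList = L at h2
    induction L with
    | nil => simp
    | cons a L ih =>
      rw [List.prod_cons, Nat.cast_mul, mul_pow, h2 a (by simp), one_mul]
      exact ih fun p hp => h2 p (by simp [hp])
  calc S.card = (S.image (fun m : ℕ => (m : ZMod ℓ))).card := by
        rw [Finset.card_image_of_injOn]
        intro a ha b hb hab
        have := (ZMod.natCast_eq_natCast_iff' a b ℓ).mp hab
        rwa [Nat.mod_eq_of_lt ((hS a ha).1.trans_lt hgt),
          Nat.mod_eq_of_lt ((hS b hb).1.trans_lt hgt)] at this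
    _ ≤ (Polynomial.nthRootsFinset n (1 : ZMod ℓ)).card := by
        apply Finset.card_le_card
        intro x hx
        obtain ⟨m, hm, rfl⟩ := Finset.mem_image.mp hx
        exact (Polynomial.mem_nthRootsFinset hn _).mpr (hpow m hm)
    _ ≤ n := by
        rw [Polynomial.nthRootsFinset_def]
        exact (Multiset.toFinset_card_le _).trans (Polynomial.card_nthRoots _ _)

theorem aux_filter (q : ℕ) (s : Multiset ℕ) (hs : ∀ x ∈ s, x ∈ insert 1 (Nat.primesLE q)) :
    UniqueFactorizationMonoid.normalizedFactors s.prod = s.filter (· ≠ 1) ∧ s.prod ≠ 0 := by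
  have h1 : s.prod = (s.filter (· ≠ 1)).prod := by
    conv_lhs => rw [← Multiset.filter_add_not (· ≠ 1) s]
    rw [Multiset.prod_add, Multiset.prod_eq_one (s := Multiset.filter (fun a => ¬ a ≠ 1) s), mul_one]
    intro x hx
    simpa using (Multiset.mem_filter.mp hx).2
  have h2 : ∀ p ∈ s.filter (· ≠ 1), p.Prime := by
    intro p hp
    obtain ⟨ha, hb⟩ := Multiset.mem_filter.mp hp
    have := hs p ha
    simp [hb, Nat.mem_primesLE] at this
    exact this.2
  constructor
  · rw [h1]
    exact UniqueFactorizationMonoid.normalizedFactors_prod_of_prime (fun p hp => (h2 p hp).prime)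
  · rw [h1]
    apply Multiset.prod_ne_zero
    intro h0
    exact Nat.not_prime_zero (h2 0 h0)

theorem aux_smooth (n ℓ q u : ℕ) (hn : 1 ≤ n) (hq : 1 ≤ q) (hℓ : ℓ.Prime) (hgt : n ^ 2 < ℓ)
    (h : ∀ p : ℕ, p.Prime → p ≤ q → (p : ZMod ℓ) ^ n = 1) (hqu : q ^ u ≤ n ^ 2) :
    (Nat.primeCounting q + u).choose u ≤ n := by
  classical
  let T : Finset ℕ := insert 1 (Nat.primesLE q)
  have hT : T.card = Nat.primeCounting q + 1 := by
    rw [Finset.card_insert_of_notMem, Nat.primesLE_card_eq_primeCounting]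
    simp [Nat.mem_primesLE, Nat.not_prime_one]
  let f : Sym T u → ℕ := fun s => ((s : Multiset T).map Subtype.val).prod
  have hmem : ∀ s : Sym T u, ∀ x ∈ (s : Multiset T).map Subtype.val, x ∈ T := by
    intro s x hx
    obtain ⟨y, -, rfl⟩ := Multiset.mem_map.mp hx
    exact y.2
  have hf : Function.Injective f := by
    intro s t hst
    have h1 := (aux_filter q _ (hmem s)).1
    have h2 := (aux_filter q _ (hmem t)).1
    have h3 : Multiset.filter (· ≠ 1) ((s : Multiset T).map Subtype.val)
       = Multiset.filter (· ≠ 1) ((t : Multiset T).map Subtype.val) := by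
      rw [← h1, ← h2]; congr 1
    have h4 : ∀ s : Sym T u, ((s : Multiset T).map Subtype.val) =
      Multiset.filter (· ≠ 1) ((s : Multiset T).map Subtype.val) +
        Multiset.replicate (u - (Multiset.filter (· ≠ 1) ((s : Multiset T).map Subtype.val)).card) 1 := by
      intro s
      conv_lhs => rw [← Multiset.filter_add_not (· ≠ 1) ((s : Multiset T).map Subtype.val)]
      congr 1
      rw [Multiset.eq_replicate]
      constructor
      · have := congrArg Multiset.card (Multiset.filter_add_not (· ≠ 1) ((s : Multiset T).map Subtype.val))
        rw [Multiset.card_add, Multiset.card_map, Sym.card_coe] at this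
        omega
      · intro b hb
        simpa using (Multiset.mem_filter.mp hb).2
    have h5 : ((s : Multiset T).map Subtype.val) = ((t : Multiset T).map Subtype.val) := by
      rw [h4 s, h4 t, h3]
    exact Sym.coe_injective (Multiset.map_injective Subtype.val_injective h5)
  have hcard := aux_roots n ℓ q hn hℓ hgt h (Finset.univ.image f) (by
    intro m hm
    obtain ⟨s, -, rfl⟩ := Finset.mem_image.mp hm
    have hfl := aux_filter q _ (hmem s)
    refine ⟨?_, hfl.2, ?_⟩
    · refine le_trans ?_ hqu
      have := Multiset.prod_le_pow_card ((s : Multiset T).map Subtype.val) q (by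
        intro x hx
        have := hmem s x hx
        simp only [T, Finset.mem_insert, Nat.mem_primesLE] at this
        rcases this with rfl | h
        · exact hq
        · exact h.1)
      simpa [f] using this
    · intro p hp
      have hp1 := Nat.prime_of_mem_primeFactorsList hp
      have hp2 : p ∈ UniqueFactorizationMonoid.normalizedFactors (f s) := by
        rw [Nat.factors_eq]; exact hp
      rw [hfl.1] at hp2
      have := hmem s p (Multiset.mem_filter.mp hp2).1
      simp only [T, Finset.mem_insert, Nat.mem_primesLE] at this
      rcases this with rfl | h
      · exact hq
      · exact h.1)
  rw [Finset.card_image_of_injective _ hf, Finset.card_univ, Sym.card_sym_eq_choose,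
    Fintype.card_coe, hT] at hcard
  convert hcard using 2
  omega

theorem aux_cheb (q : ℕ) :
    (q : ℝ) * Real.log 2 - Real.log (q + 1) ≤ Nat.primeCounting q * Real.log q :=
  (Chebyshev.psi_ge q).trans (Chebyshev.psi_le_primeCounting_mul_log q)

theorem aux_chebNat (q a c : ℕ) (hq : 1 ≤ q) (h1 : (q + 1) ^ 16 ≤ 2 ^ a) (h2 : c * a < 16 * q) :
    c ≤ Nat.primeCounting q := by
  have h := aux_cheb q
  have hq' : (1 : ℝ) ≤ q := by exact_mod_cast hq
  have hl : Real.log q ≤ Real.log (q + 1) := Real.log_le_log (by linarith) (by linarith)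
  have h3 : 16 * Real.log (q + 1) ≤ a * Real.log 2 := by
    have : ((q : ℝ) + 1) ^ 16 ≤ 2 ^ a := by exact_mod_cast h1
    have := Real.log_le_log (by positivity) this
    rw [Real.log_pow, Real.log_pow] at this
    exact_mod_cast this
  by_contra hc
  have hc' : (Nat.primeCounting q : ℝ) + 1 ≤ c := by
    have : Nat.primeCounting q + 1 ≤ c := by omega
    exact_mod_cast this
  have h2' : (c : ℝ) * a < 16 * q := by exact_mod_cast h2
  have l2 : 0 < Real.log 2 := Real.log_pos (by norm_num)
  have lq : 0 ≤ Real.log (q + 1) := Real.log_nonneg (by linarith)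
  have hpi : (0 : ℝ) ≤ Nat.primeCounting q := by positivity
  have e1 : (q : ℝ) * Real.log 2 ≤ (Nat.primeCounting q + 1) * Real.log (q + 1) := by
    nlinarith
  have e2 : (Nat.primeCounting q + 1) * Real.log (q + 1) ≤ c * Real.log (q + 1) := by
    gcongr
  have e3 : c * (16 * Real.log (q + 1)) ≤ c * (a * Real.log 2) := by gcongr
  nlinarith

theorem aux_fact (u : ℕ) (hu : 1 ≤ u) :
    Real.log (u.factorial) ≤ 1 + Real.log u / 2 + u * Real.log u - u := by
  obtain ⟨m, rfl⟩ : ∃ m, u = m + 1 := ⟨u - 1, by omega⟩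
  have h := Stirling.log_stirlingSeq'_antitone (Nat.zero_le m)
  simp only [Function.comp, Nat.succ_eq_add_one, zero_add] at h
  rw [Stirling.log_stirlingSeq_formula, Stirling.log_stirlingSeq_formula] at h
  have hm : ((m + 1 : ℕ) : ℝ) ≠ 0 := by positivity
  rw [Real.log_div hm (Real.exp_ne_zero 1), Real.log_mul (by norm_num) hm, Real.log_exp] at h
  simp only [Nat.factorial_one, Nat.cast_one, Real.log_one, mul_one,
    Real.log_div one_ne_zero (Real.exp_ne_zero 1), Real.log_exp] at h
  linarith

theorem aux_large (n : ℕ) (hL : 200 ≤ Real.log n) :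
    ∃ q u : ℕ, 1 ≤ q ∧ (q : ℝ) ≤ 4 * (1 + Real.log n ^ 2) ∧ q ^ u ≤ n ^ 2 ∧
      n < (Nat.primeCounting q + u).choose u := by
  set L := Real.log n with hLdef
  have hn0 : (0 : ℝ) < n := by
    rcases Nat.eq_zero_or_pos n with h | h
    · subst h; simp [hLdef] at hL; linarith
    · exact_mod_cast h
  set q := ⌊4 * (1 + L ^ 2)⌋₊ with hq
  have hy1 : (q : ℝ) ≤ 4 * (1 + L ^ 2) := Nat.floor_le (by positivity)
  have hy2 : 4 * (1 + L ^ 2) < q + 1 := Nat.lt_floor_add_one _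
  set y : ℝ := (q : ℝ) with hy
  have hy3 : (160000 : ℝ) ≤ y := by nlinarith
  have hq1 : 1 ≤ q := by
    have : (1 : ℝ) ≤ q := by linarith
    exact_mod_cast this
  set s := Real.log y with hs
  have hy0 : 0 < y := by linarith
  have hs1 : 1 ≤ s := by
    rw [hs, Real.le_log_iff_exp_le hy0]
    linarith [Real.exp_one_lt_d9]
  have hs0 : 0 < s := by linarith
  set u := ⌊2 * L / s⌋₊ with hu
  have hU1 : (u : ℝ) * s ≤ 2 * L := by
    rw [← le_div_iff₀ hs0]; exact Nat.floor_le (by positivity)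
  have hU2 : 2 * L < (u + 1) * s := by
    rw [← div_lt_iff₀ hs0]; exact Nat.lt_floor_add_one _
  -- relation between s and L
  have hlog2L : s / 2 - 0.01 ≤ Real.log (2 * L) := by
    have h1 : s ≤ Real.log ((2 * L) ^ 2 * (1 + 1 / L ^ 2)) := by
      apply Real.log_le_log hy0
      have : (2 * L) ^ 2 * (1 + 1 / L ^ 2) = 4 * (1 + L ^ 2) := by field_simp; ring
      rw [this]; exact hy1
    rw [Real.log_mul (by positivity) (by positivity), Real.log_pow] at h1
    have h2 : Real.log (1 + 1 / L ^ 2) ≤ 1 / L ^ 2 := by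
      have := Real.log_le_sub_one_of_pos (show 0 < 1 + 1 / L ^ 2 by positivity)
      linarith
    have h3 : 1 / L ^ 2 ≤ 1 / 200 ^ 2 := by gcongr
    norm_num at h3 h1 ⊢
    norm_num at h2
    linarith
  have hlog2L' : 2 * Real.log (2 * L) ≤ s := by
    have : Real.log ((2 * L) ^ 2) ≤ s := by
      apply Real.log_le_log (by positivity)
      nlinarith
    rw [Real.log_pow] at this
    exact_mod_cast this
  have hsL : 0.75 * s ^ 2 + 1.5 * s < L := by
    have hexp : Real.exp (s / 2) ≤ 2 * L + 1 := by
      have h1 : Real.exp (s / 2) ^ 2 = y := by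
        rw [← Real.exp_nat_mul]; push_cast
        rw [mul_div_cancel₀ _ (by norm_num), hs, Real.exp_log hy0]
      have h2 : Real.exp (s / 2) ^ 2 ≤ (2 * L + 1) ^ 2 := by rw [h1]; nlinarith
      exact le_of_sq_le_sq h2 (by positivity)
    have ht0 : 0 < s / 2 := by linarith
    have hgoal : 0.75 * s ^ 2 + 1.5 * s = 3 * (s / 2) ^ 2 + 3 * (s / 2) := by ring
    rw [hgoal]
    generalize s / 2 = t at hexp ht0
    clear_value L
    clear hgoal hlog2L hlog2L' hU1 hU2
    rcases le_or_gt t 6.5 with ht | ht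
    · nlinarith
    · have h1 : Real.exp t = Real.exp 1 ^ 6 * Real.exp (t - 6) := by
        rw [← Real.exp_nat_mul, ← Real.exp_add]; congr 1; push_cast; ring
      have h2 : (2.7 : ℝ) ^ 6 ≤ Real.exp 1 ^ 6 := by
        gcongr; linarith [Real.exp_one_gt_d9]
      have h3 : 1 + (t - 6) + (t - 6) ^ 2 / 2 ≤ Real.exp (t - 6) :=
        Real.quadratic_le_exp_of_nonneg (by linarith)
      have h4 : (2.7 : ℝ) ^ 6 * (1 + (t - 6) + (t - 6) ^ 2 / 2) ≤ Real.exp t := by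
        rw [h1]; gcongr; nlinarith
      norm_num at h4
      nlinarith
  have hUlow : 1.5 * s + 2 < u := by
    have : (1.5 * s + 3) * s < (u + 1) * s := by nlinarith
    have := lt_of_mul_lt_mul_right this hs0.le
    linarith
  have hu1 : 1 ≤ u := by
    have : (1 : ℝ) ≤ u := by linarith
    exact_mod_cast this
  have hu0 : (0 : ℝ) < u := by linarith
  refine ⟨q, u, hq1, hy1, ?_, ?_⟩
  · have : (q : ℝ) ^ u ≤ (n : ℝ) ^ 2 := by
      rw [← Real.log_le_log_iff (by positivity) (by positivity), Real.log_pow, Real.log_pow]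
      exact_mod_cast hU1
    exact_mod_cast this
  · set k := Nat.primeCounting q with hk
    have hch := aux_cheb q
    rw [← hk, ← hy, ← hs] at hch
    have hk1 : 0.69 * y ≤ (k + 1) * s := by
      have h1 : Real.log (y + 1) ≤ s + 1 := by
        have : y + 1 = y * (1 + 1 / y) := by field_simp
        rw [this, Real.log_mul (by positivity) (by positivity)]
        have h2 := Real.log_le_sub_one_of_pos (show 0 < 1 + 1 / y by positivity)
        have h3 : 1 / y ≤ 1 := by rw [div_le_one hy0]; linarith
        linarith
      have := Real.log_two_gt_d9
      nlinarith
    have hkl : Real.log 0.69 + s ≤ Real.log (k + 1) + Real.log s := by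
      rw [hs, ← Real.log_mul (by norm_num) (by positivity), ← hs,
        ← Real.log_mul (by positivity) (by positivity)]
      exact Real.log_le_log (by positivity) hk1
    have h69 : -0.45 ≤ Real.log 0.69 := by
      have := Real.one_sub_inv_le_log_of_pos (show (0 : ℝ) < 0.69 by norm_num)
      norm_num at this ⊢
      linarith
    have hsu : Real.log s + Real.log u ≤ Real.log (2 * L) := by
      rw [← Real.log_mul (by positivity) (by positivity)]
      apply Real.log_le_log (by positivity); linarith
    have hs00 : 0 ≤ Real.log s := Real.log_nonneg hs1
    have hfa := aux_fact u hu1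
    -- binomial
    have hbin : (k + 1) ^ u ≤ u.factorial * (k + u).choose u := by
      rw [← Nat.ascFactorial_eq_factorial_mul_choose]
      exact Nat.pow_succ_le_ascFactorial _ _
    have hC0 : 0 < (k + u).choose u := Nat.choose_pos (by omega)
    have hbin' : u * Real.log (k + 1) ≤ Real.log u.factorial + Real.log ((k + u).choose u) := by
      rw [← Real.log_mul (by positivity) (by positivity), ← Real.log_pow]
      apply Real.log_le_log (by positivity)
      exact_mod_cast hbin
    have hfin : L < Real.log ((k + u).choose u) := by
      have e1 : s / 2 + 0.54 ≤ Real.log (k + 1) - Real.log u + 1 := by linarith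
      have e2 : u * (s / 2 + 0.54) ≤ u * (Real.log (k + 1) - Real.log u + 1) := by gcongr
      nlinarith
    have := (Real.log_lt_log_iff hn0 (by positivity)).mp hfin
    exact_mod_cast this

def aux_isP (m : ℕ) : Bool :=
  Nat.beq (Nat.gcd (2 * m + 1) 557940830126698960967415390) 1

def aux_cnt (b : ℕ) (k : ℕ) : ℕ → ℕ :=
  Nat.rec (fun a => cond (aux_isP a) (cond (Nat.ble b a) 0 1) 0)
    (fun k ih a => cond (Nat.ble b a) 0 (Nat.add (ih a) (ih (Nat.add a (Nat.pow 2 k))))) k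

theorem aux_isP_prime (m : ℕ) (h0 : 1 ≤ m) (hm : 2 * m + 1 < 5329) (h : aux_isP m = true) :
    (2 * m + 1).Prime := by
  have h2 : Nat.gcd (2 * m + 1) 557940830126698960967415390 = 1 := Nat.eq_of_beq_eq_true h
  generalize hM : 2 * m + 1 = M at *
  by_contra hp
  have h3 := Nat.minFac_sq_le_self (by omega) hp
  have h4 : M.minFac < 73 := by nlinarith
  have h5 : M.minFac.Prime := Nat.minFac_prime (by omega)
  have h6 : ∀ p < 73, p.Prime → p ∣ 557940830126698960967415390 := by
    intro p hp hpp
    interval_cases p <;> first | (norm_num; done) | (revert hpp; norm_num)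
  have h7 := Nat.dvd_gcd (Nat.minFac_dvd M) (h6 _ h4 h5)
  rw [h2] at h7
  exact h5.one_lt.ne' (Nat.dvd_one.mp h7)

theorem aux_cnt_le (k a b : ℕ) (ha : 1 ≤ a) (hb : b ≤ 2664) :
    aux_cnt b k a ≤
      ((Finset.Ico a (a + 2 ^ k)).filter (fun m => m < b ∧ (2 * m + 1).Prime)).card := by
  induction k generalizing a with
  | zero =>
    change cond (aux_isP a) (cond (Nat.ble b a) 0 1) 0 ≤ _
    cases h1 : Nat.ble b a
    · have h1 : a < b := by
        by_contra hc
        rw [Nat.ble_eq_true_of_le (by omega)] at h1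
        exact absurd h1 (by decide)
      cases h2 : aux_isP a
      · simp
      · have := aux_isP_prime a ha (by omega) h2
        simp only [cond_false, cond_true]
        rw [Nat.one_le_iff_ne_zero, Finset.card_ne_zero]
        exact ⟨a, by simp [h1, this]⟩
    · simp
  | succ k ih =>
    change cond (Nat.ble b a) 0 (aux_cnt b k a + aux_cnt b k (a + 2 ^ k)) ≤ _
    cases h1 : Nat.ble b a
    · simp only [cond_false]
      refine (add_le_add (ih a ha) (ih (a + 2 ^ k) (ha.trans (Nat.le_add_right _ _)))).trans ?_
      rw [← Finset.card_union_of_disjoint]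
      · apply Finset.card_le_card
        intro x
        simp only [Finset.mem_union, Finset.mem_filter, Finset.mem_Ico, pow_succ]
        rintro (⟨h, h'⟩ | ⟨h, h'⟩)
        · exact ⟨⟨by omega, by omega⟩, h'⟩
        · exact ⟨⟨by omega, by omega⟩, h'⟩
      · rw [Finset.disjoint_left]
        intro x hx hy
        simp only [Finset.mem_filter, Finset.mem_Ico] at hx hy
        omega
    · simp

/-- incremental prime count on the odd numbers of `(r, q]` -/
theorem aux_pi (r d q c k : ℕ) (hr : d ≤ Nat.primeCounting r) (hr2 : 2 ≤ r) (hrq : r ≤ q)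
    (hq : q < 5327)
    (h : Nat.ble c (Nat.add d (aux_cnt ((q + 1) / 2) k ((r + 1) / 2))) = true) :
    c ≤ Nat.primeCounting q := by
  have h := Nat.le_of_ble_eq_true h
  have h1 := aux_cnt_le k ((r + 1) / 2) ((q + 1) / 2) (by omega) (by omega)
  refine h.trans ((add_le_add hr h1).trans ?_)
  rw [← Nat.primesLE_card_eq_primeCounting, ← Nat.primesLE_card_eq_primeCounting,
    ← Finset.card_image_of_injective (Finset.filter _ _) (f := fun m : ℕ => 2 * m + 1)
      (fun a b hab => by simpa using hab),
    ← Finset.card_union_of_disjoint]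
  · apply Finset.card_le_card
    intro x hx
    simp only [Finset.mem_union, Finset.mem_image, Finset.mem_filter, Finset.mem_Ico,
      Nat.mem_primesLE] at hx ⊢
    rcases hx with hx | ⟨m, ⟨hm1, hm2, hm3⟩, rfl⟩
    · exact ⟨by omega, hx.2⟩
    · exact ⟨by omega, hm3⟩
  · rw [Finset.disjoint_left]
    intro x hx hy
    simp only [Finset.mem_image, Finset.mem_filter, Finset.mem_Ico,
      Nat.mem_primesLE] at hx hy
    obtain ⟨m, ⟨hm1, hm2, hm3⟩, rfl⟩ := hy
    omega

theorem aux_pi_32 : 11 ≤ Nat.primeCounting 32 := by decide +kernel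

theorem aux_pi_50 : 15 ≤ Nat.primeCounting 50 := by decide +kernel

theorem aux_pi_64 : 18 ≤ Nat.primeCounting 64 := by decide +kernel

theorem aux_pi_72 : 20 ≤ Nat.primeCounting 72 := by decide +kernel

theorem aux_pi_80 : 22 ≤ Nat.primeCounting 80 :=
  aux_pi 72 20 80 22 2 aux_pi_72 (by norm_num) (by norm_num) (by norm_num) (by decide +kernel)

theorem aux_pi_112 : 29 ≤ Nat.primeCounting 112 :=
  aux_pi 80 22 112 29 4 aux_pi_80 (by norm_num) (by norm_num) (by norm_num) (by decide +kernel)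

theorem aux_pi_161 : 37 ≤ Nat.primeCounting 161 :=
  aux_pi 112 29 161 37 5 aux_pi_112 (by norm_num) (by norm_num) (by norm_num) (by decide +kernel)

theorem aux_pi_215 : 47 ≤ Nat.primeCounting 215 :=
  aux_pi 161 37 215 47 5 aux_pi_161 (by norm_num) (by norm_num) (by norm_num) (by decide +kernel)

theorem aux_pi_328 : 66 ≤ Nat.primeCounting 328 :=
  aux_pi 215 47 328 66 6 aux_pi_215 (by norm_num) (by norm_num) (by norm_num) (by decide +kernel)

theorem aux_pi_430 : 82 ≤ Nat.primeCounting 430 :=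
  aux_pi 328 66 430 82 6 aux_pi_328 (by norm_num) (by norm_num) (by norm_num) (by decide +kernel)

theorem aux_pi_776 : 137 ≤ Nat.primeCounting 776 :=
  aux_pi 430 82 776 137 8 aux_pi_430 (by norm_num) (by norm_num) (by norm_num) (by decide +kernel)

theorem aux_pi_851 : 146 ≤ Nat.primeCounting 851 :=
  aux_pi 776 137 851 146 6 aux_pi_776 (by norm_num) (by norm_num) (by norm_num) (by decide +kernel)

theorem aux_pi_1564 : 246 ≤ Nat.primeCounting 1564 :=
  aux_pi 851 146 1564 246 9 aux_pi_851 (by norm_num) (by norm_num) (by norm_num) (by decide +kernel)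

theorem aux_pi_1824 : 281 ≤ Nat.primeCounting 1824 :=
  aux_pi 1564 246 1824 281 8 aux_pi_1564 (by norm_num) (by norm_num) (by norm_num) (by decide +kernel)

theorem aux_pi_2261 : 335 ≤ Nat.primeCounting 2261 :=
  aux_pi 1824 281 2261 335 8 aux_pi_1824 (by norm_num) (by norm_num) (by norm_num) (by decide +kernel)

theorem aux_pi_3158 : 446 ≤ Nat.primeCounting 3158 :=
  aux_pi 2261 335 3158 446 9 aux_pi_2261 (by norm_num) (by norm_num) (by norm_num) (by decide +kernel)

theorem aux_pi_4778 : 641 ≤ Nat.primeCounting 4778 :=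
  aux_pi 3158 446 4778 641 10 aux_pi_3158 (by norm_num) (by norm_num) (by norm_num) (by decide +kernel)

theorem aux_log (n i q : ℕ) (h0 : 2 ^ i ≤ n ^ 2)
    (hq : 1000000 * q ≤ 4000000 + 480452 * i ^ 2) :
    (q : ℝ) ≤ 4 * (1 + Real.log n ^ 2) := by
  have h0' : (2 : ℝ) ^ i ≤ (n : ℝ) ^ 2 := by exact_mod_cast h0
  have h1 := Real.log_le_log (by positivity) h0'
  rw [Real.log_pow, Real.log_pow] at h1
  have hq' : (1000000 : ℝ) * q ≤ 4000000 + 480452 * (i : ℝ) ^ 2 := by exact_mod_cast hq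
  have l2 := Real.log_two_gt_d9
  have hi : (0 : ℝ) ≤ i := by positivity
  have h2 : 0.693147 * (i : ℝ) ≤ 2 * Real.log n := by
    push_cast at h1
    nlinarith
  have h3 : (0.693147 * (i : ℝ)) ^ 2 ≤ (2 * Real.log n) ^ 2 := by gcongr
  nlinarith [sq_nonneg (i : ℝ)]

theorem aux_row (n ℓ i0 i1 q u c : ℕ) (hℓ : ℓ.Prime) (hgt : n ^ 2 < ℓ)
    (h : ∀ p : ℕ, p.Prime → (p : ℝ) ≤ 4 * (1 + Real.log n ^ 2) → (p : ZMod ℓ) ^ n = 1)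
    (hq : 1 ≤ q) (h0 : 2 ^ i0 ≤ n ^ 2) (h1 : n ^ 2 < 2 ^ i1)
    (hqi : 1000000 * q ≤ 4000000 + 480452 * i0 ^ 2) (hqu : q ^ u ≤ 2 ^ i0)
    (hc : c ≤ Nat.primeCounting q)
    (hC : 2 ^ i1 * u.factorial ^ 2 ≤ (c + 1).ascFactorial u ^ 2) : False := by
  have hn : 1 ≤ n := by
    rcases Nat.eq_zero_or_pos n with rfl | h'
    · have : 0 < 2 ^ i0 := by positivity
      simp at h0
    · exact h'
  have hle := aux_log n i0 q h0 hqi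
  have h2 := aux_smooth n ℓ q u hn hq hℓ hgt
    (fun p hp hpq => h p hp (le_trans (by exact_mod_cast hpq) hle)) (hqu.trans h0)
  have h3 : (c + u).choose u ≤ n := (Nat.choose_le_choose u (by omega)).trans h2
  rw [Nat.ascFactorial_eq_factorial_mul_choose, mul_pow, mul_comm] at hC
  have h4 := Nat.le_of_mul_le_mul_left hC (by positivity)
  have h5 : (c + u).choose u ^ 2 ≤ n ^ 2 := Nat.pow_le_pow_left h3 2
  omega

theorem aux_rowS (n ℓ i0 q : ℕ) (hn : 1 ≤ n) (hℓ : ℓ.Prime) (hgt : n ^ 2 < ℓ)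
    (h : ∀ p : ℕ, p.Prime → (p : ℝ) ≤ 4 * (1 + Real.log n ^ 2) → (p : ZMod ℓ) ^ n = 1)
    (h0 : 2 ^ i0 ≤ n ^ 2) (h1 : n < q)
    (hqi : 1000000 * q ≤ 4000000 + 480452 * i0 ^ 2) (hqu : q ≤ 2 ^ i0) : False := by
  have hle := aux_log n i0 q h0 hqi
  have := aux_roots n ℓ q hn hℓ hgt
    (fun p hp hpq => h p hp (le_trans (by exact_mod_cast hpq) hle)) (Finset.Icc 1 q) (by
      intro m hm
      rw [Finset.mem_Icc] at hm
      exact ⟨by omega, by omega, fun p hp => (Nat.le_of_mem_primeFactorsList hp).trans hm.2⟩)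
  simp at this
  omega

theorem aux_exists (n ℓ : ℕ) (hn : 1 ≤ n) (hℓ : ℓ.Prime) (hgt : n ^ 2 < ℓ)
    (h : ∀ p : ℕ, p.Prime → (p : ℝ) ≤ 4 * (1 + Real.log n ^ 2) → (p : ZMod ℓ) ^ n = 1) :
    False := by
  rcases Nat.lt_or_ge n 2 with h2 | h2
  · obtain rfl : n = 1 := by omega
    have := h 2 Nat.prime_two (by simp; norm_num)
    have : Fact ℓ.Prime := ⟨hℓ⟩
    have h3 : (1 : ZMod ℓ) = 0 := by
      have h4 : (2 : ZMod ℓ) = 1 := by simpa using h 2 Nat.prime_two (by simp; norm_num)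
      linear_combination h4
    exact one_ne_zero h3
  rcases Nat.lt_or_ge n 4 with h4 | h4
  · exact aux_rowS n ℓ 2 4 hn hℓ hgt h (by nlinarith) h4 (by norm_num) (by norm_num)
  rcases Nat.lt_or_ge n 8 with h8 | h8
  · exact aux_rowS n ℓ 4 11 hn hℓ hgt h (by nlinarith) (by omega) (by norm_num) (by norm_num)
  rcases Nat.lt_or_ge n 16 with h16 | h16
  · exact aux_rowS n ℓ 6 21 hn hℓ hgt h (by nlinarith) (by omega) (by norm_num) (by norm_num)
  rcases Nat.lt_or_ge n 32 with h32 | h32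
  · exact aux_rowS n ℓ 8 34 hn hℓ hgt h (by nlinarith) (by omega) (by norm_num) (by norm_num)
  have h0 : 2 ^ 10 ≤ n ^ 2 := by nlinarith
  clear h2 h4 h8 h16 h32
  rcases lt_or_ge (n ^ 2) (2 ^ 12) with h1 | h1
  · exact aux_row n ℓ 10 12 32 2 11 hℓ hgt h (by norm_num) h0 h1 (by norm_num) (by decide +kernel)
      aux_pi_32 (by decide +kernel)
  clear h0; rename' h1 => h0
  rcases lt_or_ge (n ^ 2) (2 ^ 15) with h1 | h1
  · exact aux_row n ℓ 12 15 64 2 18 hℓ hgt h (by norm_num) h0 h1 (by norm_num) (by decide +kernel)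
      aux_pi_64 (by decide +kernel)
  clear h0; rename' h1 => h0
  rcases lt_or_ge (n ^ 2) (2 ^ 17) with h1 | h1
  · exact aux_row n ℓ 15 17 112 2 29 hℓ hgt h (by norm_num) h0 h1 (by norm_num) (by decide +kernel)
      aux_pi_112 (by decide +kernel)
  clear h0; rename' h1 => h0
  rcases lt_or_ge (n ^ 2) (2 ^ 19) with h1 | h1
  · exact aux_row n ℓ 17 19 50 3 15 hℓ hgt h (by norm_num) h0 h1 (by norm_num) (by decide +kernel)
      aux_pi_50 (by decide +kernel)
  clear h0; rename' h1 => h0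
  rcases lt_or_ge (n ^ 2) (2 ^ 22) with h1 | h1
  · exact aux_row n ℓ 19 22 80 3 22 hℓ hgt h (by norm_num) h0 h1 (by norm_num) (by decide +kernel)
      aux_pi_80 (by decide +kernel)
  clear h0; rename' h1 => h0
  rcases lt_or_ge (n ^ 2) (2 ^ 26) with h1 | h1
  · exact aux_row n ℓ 22 26 161 3 37 hℓ hgt h (by norm_num) h0 h1 (by norm_num) (by decide +kernel)
      aux_pi_161 (by decide +kernel)
  clear h0; rename' h1 => h0
  rcases lt_or_ge (n ^ 2) (2 ^ 31) with h1 | h1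
  · exact aux_row n ℓ 26 31 328 3 66 hℓ hgt h (by norm_num) h0 h1 (by norm_num) (by decide +kernel)
      aux_pi_328 (by decide +kernel)
  clear h0; rename' h1 => h0
  rcases lt_or_ge (n ^ 2) (2 ^ 35) with h1 | h1
  · exact aux_row n ℓ 31 35 215 4 47 hℓ hgt h (by norm_num) h0 h1 (by norm_num) (by decide +kernel)
      aux_pi_215 (by decide +kernel)
  clear h0; rename' h1 => h0
  rcases lt_or_ge (n ^ 2) (2 ^ 42) with h1 | h1
  · exact aux_row n ℓ 35 42 430 4 82 hℓ hgt h (by norm_num) h0 h1 (by norm_num) (by decide +kernel)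
      aux_pi_430 (by decide +kernel)
  clear h0; rename' h1 => h0
  rcases lt_or_ge (n ^ 2) (2 ^ 48) with h1 | h1
  · exact aux_row n ℓ 42 48 851 4 146 hℓ hgt h (by norm_num) h0 h1 (by norm_num) (by decide +kernel)
      aux_pi_851 (by decide +kernel)
  clear h0; rename' h1 => h0
  rcases lt_or_ge (n ^ 2) (2 ^ 57) with h1 | h1
  · exact aux_row n ℓ 48 57 776 5 137 hℓ hgt h (by norm_num) h0 h1 (by norm_num) (by decide +kernel)
      aux_pi_776 (by decide +kernel)
  clear h0; rename' h1 => h0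
  rcases lt_or_ge (n ^ 2) (2 ^ 65) with h1 | h1
  · exact aux_row n ℓ 57 65 1564 5 246 hℓ hgt h (by norm_num) h0 h1 (by norm_num) (by decide +kernel)
      aux_pi_1564 (by decide +kernel)
  clear h0; rename' h1 => h0
  rcases lt_or_ge (n ^ 2) (2 ^ 78) with h1 | h1
  · exact aux_row n ℓ 65 78 1824 6 281 hℓ hgt h (by norm_num) h0 h1 (by norm_num) (by decide +kernel)
      aux_pi_1824 (by decide +kernel)
  clear h0; rename' h1 => h0
  rcases lt_or_ge (n ^ 2) (2 ^ 93) with h1 | h1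
  · exact aux_row n ℓ 78 93 2261 7 335 hℓ hgt h (by norm_num) h0 h1 (by norm_num) (by decide +kernel)
      aux_pi_2261 (by decide +kernel)
  clear h0; rename' h1 => h0
  rcases lt_or_ge (n ^ 2) (2 ^ 110) with h1 | h1
  · exact aux_row n ℓ 93 110 3158 8 446 hℓ hgt h (by norm_num) h0 h1 (by norm_num) (by decide +kernel)
      aux_pi_3158 (by decide +kernel)
  clear h0; rename' h1 => h0
  rcases lt_or_ge (n ^ 2) (2 ^ 131) with h1 | h1
  · exact aux_row n ℓ 110 131 4778 9 641 hℓ hgt h (by norm_num) h0 h1 (by norm_num) (by decide +kernel)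
      aux_pi_4778 (by decide +kernel)
  clear h0; rename' h1 => h0
  rcases lt_or_ge (n ^ 2) (2 ^ 142) with h1 | h1
  · exact aux_row n ℓ 131 142 8249 10 631 hℓ hgt h (by norm_num) h0 h1 (by norm_num) (by decide +kernel)
      (aux_chebNat 8249 209 631 (by norm_num) (by decide +kernel) (by norm_num)) (by decide +kernel)
  clear h0; rename' h1 => h0
  rcases lt_or_ge (n ^ 2) (2 ^ 152) with h1 | h1
  · exact aux_row n ℓ 142 152 7691 11 594 hℓ hgt h (by norm_num) h0 h1 (by norm_num) (by decide +kernel)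
      (aux_chebNat 7691 207 594 (by norm_num) (by decide +kernel) (by norm_num)) (by decide +kernel)
  clear h0; rename' h1 => h0
  rcases lt_or_ge (n ^ 2) (2 ^ 162) with h1 | h1
  · exact aux_row n ℓ 152 162 11104 11 822 hℓ hgt h (by norm_num) h0 h1 (by norm_num) (by decide +kernel)
      (aux_chebNat 11104 216 822 (by norm_num) (by decide +kernel) (by norm_num)) (by decide +kernel)
  clear h0; rename' h1 => h0
  rcases lt_or_ge (n ^ 2) (2 ^ 176) with h1 | h1
  · exact aux_row n ℓ 162 176 11585 12 854 hℓ hgt h (by norm_num) h0 h1 (by norm_num) (by decide +kernel)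
      (aux_chebNat 11585 217 854 (by norm_num) (by decide +kernel) (by norm_num)) (by decide +kernel)
  clear h0; rename' h1 => h0
  rcases lt_or_ge (n ^ 2) (2 ^ 189) with h1 | h1
  · exact aux_row n ℓ 176 189 11898 13 877 hℓ hgt h (by norm_num) h0 h1 (by norm_num) (by decide +kernel)
      (aux_chebNat 11898 217 877 (by norm_num) (by decide +kernel) (by norm_num)) (by decide +kernel)
  clear h0; rename' h1 => h0
  rcases lt_or_ge (n ^ 2) (2 ^ 201) with h1 | h1
  · exact aux_row n ℓ 189 201 17166 13 1215 hℓ hgt h (by norm_num) h0 h1 (by norm_num) (by decide +kernel)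
      (aux_chebNat 17166 226 1215 (by norm_num) (by decide +kernel) (by norm_num)) (by decide +kernel)
  clear h0; rename' h1 => h0
  rcases lt_or_ge (n ^ 2) (2 ^ 219) with h1 | h1
  · exact aux_row n ℓ 201 219 19414 14 1362 hℓ hgt h (by norm_num) h0 h1 (by norm_num) (by decide +kernel)
      (aux_chebNat 19414 228 1362 (by norm_num) (by decide +kernel) (by norm_num)) (by decide +kernel)
  clear h0; rename' h1 => h0
  rcases lt_or_ge (n ^ 2) (2 ^ 238) with h1 | h1
  · exact aux_row n ℓ 219 238 23046 15 1589 hℓ hgt h (by norm_num) h0 h1 (by norm_num) (by decide +kernel)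
      (aux_chebNat 23046 232 1589 (by norm_num) (by decide +kernel) (by norm_num)) (by decide +kernel)
  clear h0; rename' h1 => h0
  rcases lt_or_ge (n ^ 2) (2 ^ 258) with h1 | h1
  · exact aux_row n ℓ 238 258 27218 16 1845 hℓ hgt h (by norm_num) h0 h1 (by norm_num) (by decide +kernel)
      (aux_chebNat 27218 236 1845 (by norm_num) (by decide +kernel) (by norm_num)) (by decide +kernel)
  clear h0; rename' h1 => h0
  rcases lt_or_ge (n ^ 2) (2 ^ 279) with h1 | h1
  · exact aux_row n ℓ 258 279 31984 17 2132 hℓ hgt h (by norm_num) h0 h1 (by norm_num) (by decide +kernel)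
      (aux_chebNat 31984 240 2132 (by norm_num) (by decide +kernel) (by norm_num)) (by decide +kernel)
  clear h0; rename' h1 => h0
  rcases lt_or_ge (n ^ 2) (2 ^ 300) with h1 | h1
  · exact aux_row n ℓ 279 300 37402 18 2452 hℓ hgt h (by norm_num) h0 h1 (by norm_num) (by decide +kernel)
      (aux_chebNat 37402 244 2452 (by norm_num) (by decide +kernel) (by norm_num)) (by decide +kernel)
  clear h0; rename' h1 => h0
  rcases lt_or_ge (n ^ 2) (2 ^ 321) with h1 | h1
  · exact aux_row n ℓ 300 321 43244 19 2801 hℓ hgt h (by norm_num) h0 h1 (by norm_num) (by decide +kernel)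
      (aux_chebNat 43244 247 2801 (by norm_num) (by decide +kernel) (by norm_num)) (by decide +kernel)
  clear h0; rename' h1 => h0
  rcases lt_or_ge (n ^ 2) (2 ^ 345) with h1 | h1
  · exact aux_row n ℓ 321 345 39944 21 2608 hℓ hgt h (by norm_num) h0 h1 (by norm_num) (by decide +kernel)
      (aux_chebNat 39944 245 2608 (by norm_num) (by decide +kernel) (by norm_num)) (by decide +kernel)
  clear h0; rename' h1 => h0
  rcases lt_or_ge (n ^ 2) (2 ^ 375) with h1 | h1
  · exact aux_row n ℓ 345 375 52565 22 3350 hℓ hgt h (by norm_num) h0 h1 (by norm_num) (by decide +kernel)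
      (aux_chebNat 52565 251 3350 (by norm_num) (by decide +kernel) (by norm_num)) (by decide +kernel)
  clear h0; rename' h1 => h0
  rcases lt_or_ge (n ^ 2) (2 ^ 405) with h1 | h1
  · exact aux_row n ℓ 375 405 67567 23 4206 hℓ hgt h (by norm_num) h0 h1 (by norm_num) (by decide +kernel)
      (aux_chebNat 67567 257 4206 (by norm_num) (by decide +kernel) (by norm_num)) (by decide +kernel)
  clear h0; rename' h1 => h0
  rcases lt_or_ge (n ^ 2) (2 ^ 441) with h1 | h1
  · exact aux_row n ℓ 405 441 75281 25 4632 hℓ hgt h (by norm_num) h0 h1 (by norm_num) (by decide +kernel)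
      (aux_chebNat 75281 260 4632 (by norm_num) (by decide +kernel) (by norm_num)) (by decide +kernel)
  clear h0; rename' h1 => h0
  rcases lt_or_ge (n ^ 2) (2 ^ 478) with h1 | h1
  · exact aux_row n ℓ 441 478 82570 27 5042 hℓ hgt h (by norm_num) h0 h1 (by norm_num) (by decide +kernel)
      (aux_chebNat 82570 262 5042 (by norm_num) (by decide +kernel) (by norm_num)) (by decide +kernel)
  clear h0; rename' h1 => h0
  rcases lt_or_ge (n ^ 2) (2 ^ 516) with h1 | h1
  · exact aux_row n ℓ 478 516 91580 29 5550 hℓ hgt h (by norm_num) h0 h1 (by norm_num) (by decide +kernel)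
      (aux_chebNat 91580 264 5550 (by norm_num) (by decide +kernel) (by norm_num)) (by decide +kernel)
  clear h0; rename' h1 => h0
  rcases lt_or_ge (n ^ 2) (2 ^ 557) with h1 | h1
  · exact aux_row n ℓ 516 557 127927 30 7525 hℓ hgt h (by norm_num) h0 h1 (by norm_num) (by decide +kernel)
      (aux_chebNat 127927 272 7525 (by norm_num) (by decide +kernel) (by norm_num)) (by decide +kernel)
  clear h0; rename' h1 => h0
  rcases lt_or_ge (n ^ 2) (2 ^ 602) with h1 | h1
  · exact aux_row n ℓ 557 602 149063 32 8672 hℓ hgt h (by norm_num) h0 h1 (by norm_num) (by decide +kernel)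
      (aux_chebNat 149063 275 8672 (by norm_num) (by decide +kernel) (by norm_num)) (by decide +kernel)
  clear h0; rename' h1 => h0
  have hL : 200 ≤ Real.log n := by
    have h0' : (2 : ℝ) ^ 602 ≤ (n : ℝ) ^ 2 := by exact_mod_cast h0
    have h1 := Real.log_le_log (by positivity) h0'
    rw [Real.log_pow, Real.log_pow] at h1
    push_cast at h1
    linarith [Real.log_two_gt_d9]
  obtain ⟨q, u, hq, hqB, hqu, hlt⟩ := aux_large n hL
  have := aux_smooth n ℓ q u hn hq hℓ hgt
    (fun p hp hpq => h p hp (le_trans (by exact_mod_cast hpq) hqB)) hqu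
  omega

/-- For an order `A` of ℤ-rank `n ≥ 1` and a prime `ℓ > n²`, there is a maximal
ideal `𝔭` of `A` containing a prime number `p ≤ 4(1 + (log n)²)` with
`#(A/𝔭) ≢ 1 (mod ℓ)`. -/
theorem stmt13 (A : Type*) [CommRing A] [Module.Free ℤ A] [Module.Finite ℤ A]
    (hn : 1 ≤ Module.finrank ℤ A)
    (ℓ : ℕ) (hℓ : ℓ.Prime) (hgt : (Module.finrank ℤ A) ^ 2 < ℓ) :
    ∃ 𝔭 : Ideal A, 𝔭.IsMaximal ∧ Finite (A ⧸ 𝔭) ∧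
      (∃ p : ℕ, p.Prime ∧
        (p : ℝ) ≤ 4 * (1 + (Real.log (Module.finrank ℤ A)) ^ 2) ∧ (p : A) ∈ 𝔭) ∧
      ¬ (ℓ : ℤ) ∣ (Nat.card (A ⧸ 𝔭) : ℤ) - 1 := by
  by_contra hcon
  refine aux_exists (Module.finrank ℤ A) ℓ hn hℓ hgt ?_
  intro p hp hpB
  by_contra hne
  obtain ⟨I, hI, hf, hpI, hd⟩ := aux_alg A ℓ p hp hne
  exact hcon ⟨I, hI, hf, ⟨p, hp, hpB, hpI⟩, hd⟩
end

section
/- Let A be a CM-order, L an A-lattice, a ∈ A, and x ∈ L. Then ⟨ax, ax⟩ ≤ (a,a)·⟨x,x⟩, where (a,a) = Tr_{A/ℤ}(a·ā). -/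
open scoped ComplexOrder in
theorem aux_trace (A : Type*) [CommRing A] {ι : Type*} [Fintype ι] [DecidableEq ι]
    (b : Module.Basis ι ℤ A) (c : A) (hc : ∀ ψ : A →+* ℂ, 0 ≤ ψ c)
    (μ : ℂ) (hμ : μ ∈ spectrum ℂ ((Algebra.leftMulMatrix b c).map (Int.castRingHom ℂ))) :
    ‖μ‖ ≤ (Algebra.trace ℤ A c : ℝ) := by
  classical
  set M := (Algebra.leftMulMatrix b c).map (Int.castRingHom ℂ) with hM
  have key : ∀ ν ∈ spectrum ℂ M, 0 ≤ ν := by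
    intro ν hν
    have hfin : Module.Finite ℤ A := Module.Finite.of_basis b
    have h1 : M = Algebra.leftMulMatrix (b.baseChange ℂ) ((1 : ℂ) ⊗ₜ[ℤ] c) := by
      ext i j
      simp [hM, Algebra.leftMulMatrix_eq_repr_mul]
    rw [h1] at hν
    have h2 := AlgHom.spectrum_apply_subset (Algebra.leftMulMatrix (b.baseChange ℂ)) _ hν
    rw [spectrum.mem_iff] at h2
    obtain ⟨m, hm, hmem⟩ := exists_max_ideal_of_mem_nonunits (mem_nonunits_iff.mpr h2)
    let _ : Field (TensorProduct ℤ ℂ A ⧸ m) := Ideal.Quotient.field m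
    let φ : (TensorProduct ℤ ℂ A ⧸ m) →ₐ[ℂ] ℂ := IsAlgClosed.lift
    let φ' : TensorProduct ℤ ℂ A →ₐ[ℂ] ℂ := φ.comp (Ideal.Quotient.mkₐ ℂ m)
    have h3 : φ' (algebraMap ℂ _ ν - (1 : ℂ) ⊗ₜ[ℤ] c) = 0 := by
      have : Ideal.Quotient.mkₐ ℂ m (algebraMap ℂ _ ν - (1 : ℂ) ⊗ₜ[ℤ] c) = 0 := by
        simpa [Ideal.Quotient.eq_zero_iff_mem] using Ideal.Quotient.eq_zero_iff_mem.mpr hmem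
      simp only [φ', AlgHom.comp_apply, this, map_zero]
    rw [map_sub, AlgHom.commutes, sub_eq_zero] at h3
    have h4 := hc ((φ' : TensorProduct ℤ ℂ A →+* ℂ).comp
      (Algebra.TensorProduct.includeRight : A →ₐ[ℤ] TensorProduct ℤ ℂ A).toRingHom)
    have h5 : ν = φ' ((1 : ℂ) ⊗ₜ[ℤ] c) := h3
    rw [h5]
    exact h4
  have htr : ((Algebra.trace ℤ A c : ℤ) : ℂ) = M.charpoly.roots.sum := by
    rw [← Matrix.trace_eq_sum_roots_charpoly, Algebra.trace_eq_matrix_trace b]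
    simp [hM, Matrix.trace]
  have hroot : ∀ ν, ν ∈ M.charpoly.roots ↔ ν ∈ spectrum ℂ M := by
    intro ν
    rw [Matrix.mem_spectrum_iff_isRoot_charpoly, Polynomial.mem_roots M.charpoly_monic.ne_zero]
  have hle : μ ≤ ((Algebra.trace ℤ A c : ℤ) : ℂ) := by
    rw [htr]
    exact Multiset.single_le_sum (fun ν h => key ν ((hroot ν).1 h)) μ ((hroot μ).2 hμ)
  have h0 := key μ hμ
  have h6 : (‖μ‖ : ℂ) = μ := Complex.norm_of_nonneg' h0
  rw [← h6] at hle
  exact_mod_cast hle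

theorem aux_gelfand {E : Type*} [NormedRing E] [NormedAlgebra ℂ E] [CompleteSpace E]
    (M : E) (t s : ℝ) (ht : 0 ≤ t) (hs : t < s) (h : ∀ μ ∈ spectrum ℂ M, ‖μ‖ ≤ t) :
    ∀ᶠ n : ℕ in Filter.atTop, ‖M ^ n‖ ≤ s ^ n := by
  have h1 : spectralRadius ℂ M ≤ ENNReal.ofReal t := by
    unfold spectralRadius
    refine iSup₂_le fun μ hμ => ?_
    have : (‖μ‖₊ : ENNReal) = ENNReal.ofReal ‖μ‖ := (ofReal_norm μ).symm
    rw [this]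
    exact ENNReal.ofReal_le_ofReal (h μ hμ)
  have h2 : spectralRadius ℂ M < ENNReal.ofReal s :=
    h1.trans_lt ((ENNReal.ofReal_lt_ofReal_iff (ht.trans_lt hs)).2 hs)
  have h3 := (spectrum.pow_norm_pow_one_div_tendsto_nhds_spectralRadius M).eventually_lt_const h2
  filter_upwards [h3, Filter.eventually_gt_atTop 0] with n hn hn0
  have h4 := (ENNReal.ofReal_lt_ofReal_iff (ht.trans_lt hs)).1 hn
  have h5 : (‖M ^ n‖ ^ (1 / n : ℝ)) ^ n ≤ s ^ n := pow_le_pow_left₀ (by positivity) h4.le n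
  rwa [← Real.rpow_natCast, ← Real.rpow_mul (norm_nonneg _), one_div,
    inv_mul_cancel₀ (by positivity), Real.rpow_one] at h5

theorem aux_lin {E : Type*} [NormedRing E] [NormedAlgebra ℂ E] [FiniteDimensional ℂ E]
    (M : E) (t s : ℝ) (ht : 0 ≤ t) (hs : t < s) (h : ∀ μ ∈ spectrum ℂ M, ‖μ‖ ≤ t)
    (g : E →ₗ[ℂ] ℂ) :
    ∃ C : ℝ, ∀ᶠ n : ℕ in Filter.atTop, ‖g (M ^ n)‖ ≤ C * s ^ n := by
  have : CompleteSpace E := FiniteDimensional.complete ℂ _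
  let g' := LinearMap.toContinuousLinearMap g
  refine ⟨‖g'‖, ?_⟩
  filter_upwards [aux_gelfand M t s ht hs h] with n hn
  exact (g'.le_opNorm (M ^ n)).trans (mul_le_mul_of_nonneg_left hn (norm_nonneg _))

theorem aux_matrix {ι : Type*} [Fintype ι] [DecidableEq ι]
    (M : Matrix ι ι ℂ) (t s : ℝ) (ht : 0 ≤ t) (hs : t < s) (h : ∀ μ ∈ spectrum ℂ M, ‖μ‖ ≤ t)
    (g : Matrix ι ι ℂ →ₗ[ℂ] ℂ) :
    ∃ C : ℝ, ∀ᶠ n : ℕ in Filter.atTop, ‖g (M ^ n)‖ ≤ C * s ^ n := by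
  let _ := Matrix.linftyOpNormedRing (n := ι) (α := ℂ)
  let _ := Matrix.linftyOpNormedAlgebra (n := ι) (R := ℂ) (α := ℂ)
  exact aux_lin M t s ht hs h g

theorem aux_real (u : ℕ → ℝ) (t : ℝ) (h0 : 0 < u 0) (hn : ∀ n, 0 ≤ u n)
    (hcs : ∀ n, u n ^ 2 ≤ u (2 * n) * u 0)
    (hb : ∀ s, t < s → ∃ C : ℝ, ∀ᶠ n : ℕ in Filter.atTop, u n ≤ C * s ^ n) (ht : 0 ≤ t) :
    u 1 ≤ t * u 0 := by
  rw [← div_le_iff₀ h0]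
  refine le_of_forall_gt_imp_ge_of_dense fun s hs => ?_
  obtain ⟨C, hC⟩ := hb s hs
  by_contra! hlt
  have hs0 : 0 < s := ht.trans_lt hs
  have hpow : ∀ k : ℕ, (u 1 / u 0) ^ (2 ^ k) ≤ u (2 ^ k) / u 0 := by
    intro k
    induction k with
    | zero => simp
    | succ k ih =>
      rw [pow_succ, pow_mul]
      calc ((u 1 / u 0) ^ (2 ^ k)) ^ 2 ≤ (u (2 ^ k) / u 0) ^ 2 :=
            pow_le_pow_left₀ (pow_nonneg (div_nonneg (hn 1) h0.le) _) ih 2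
        _ ≤ _ := by
            rw [div_pow, div_le_div_iff₀ (by positivity) h0, mul_comm (2 ^ k) 2]
            nlinarith [hcs (2 ^ k)]
  have h2 : Filter.Tendsto (fun k : ℕ => 2 ^ k) Filter.atTop (Filter.atTop : Filter ℕ) :=
    tendsto_pow_atTop_atTop_of_one_lt (by norm_num)
  have h3 := (tendsto_pow_atTop_atTop_of_one_lt ((one_lt_div hs0).2 hlt)).comp h2
  obtain ⟨k, hk1, hk2⟩ := ((h2.eventually hC).and (h3.eventually_gt_atTop (C / u 0))).exists
  have h4 := hpow k
  simp only [Function.comp] at hk2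
  rw [div_pow, lt_div_iff₀ (by positivity)] at hk2
  have h5 : u (2 ^ k) / u 0 ≤ C / u 0 * s ^ (2 ^ k) := by
    rw [div_mul_eq_mul_div]
    exact div_le_div_of_nonneg_right hk1 h0.le
  linarith

/-- For a CM-order `A`, an `A`-lattice `L`, `a ∈ A` and `x ∈ L`:
`⟨ax, ax⟩ ≤ (a,a)·⟨x,x⟩`, where `(a,a) = Tr_{A/ℤ}(a·σ a)`. -/
theorem stmt16 (A : Type*) [CommRing A] [IsReduced A]
    [Module.Free ℤ A] [Module.Finite ℤ A]
    (σ : A ≃+* A)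
    (hσ : ∀ (ψ : A →+* ℂ) (x : A), ψ (σ x) = starRingEnd ℂ (ψ x))
    (L : Type*) [AddCommGroup L] [Module A L]
    [Module.Free ℤ L] [Module.Finite ℤ L]
    (B : L → L → ℤ)
    (hadd1 : ∀ x x' y : L, B (x + x') y = B x y + B x' y)
    (hadd2 : ∀ x y y' : L, B x (y + y') = B x y + B x y')
    (hsymm : ∀ x y : L, B x y = B y x)
    (hposdef : ∀ x : L, x ≠ 0 → 0 < B x x)
    (hcompat : ∀ (a : A) (x y : L), B (a • x) y = B x (σ a • y))
    (a : A) (x : L) :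
    B (a • x) (a • x) ≤ Algebra.trace ℤ A (a * σ a) * B x x := by
  classical
  have hz : B 0 0 = 0 := by have := hadd1 0 0 0; simp at this; exact this
  by_cases hx : x = 0
  · simp [hx, hz]
  have hnn : ∀ y, 0 ≤ B y y := fun y => by
    by_cases hy : y = 0
    · rw [hy, hz]
    · exact (hposdef y hy).le
  have hp := hposdef x hx
  have hsm : ∀ (n : ℤ) (y z : L), B (n • y) z = n * B y z := fun n y z => by
    simpa using map_zsmul (AddMonoidHom.mk' (fun y => B y z) (fun y y' => hadd1 y y' z)) n y
  have hsm2 : ∀ (n : ℤ) (y z : L), B z (n • y) = n * B z y := fun n y z => by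
    rw [hsymm, hsm, hsymm]
  have hcs : ∀ y, B y x ^ 2 ≤ B y y * B x x := by
    intro y
    have h := hnn (B x x • y + (-(B y x)) • x)
    simp only [hadd1, hadd2, hsm, hsm2, hsymm x y] at h
    have h' : 0 ≤ B x x * (B y y * B x x - B y x ^ 2) := by linarith
    have := nonneg_of_mul_nonneg_right h' hp
    linarith
  set c := a * σ a with hc
  have hadj : ∀ y z, B (c • y) z = B y (c • z) := by
    have h : ∀ y z, B (c • y) z = B (σ a • y) (σ a • z) := fun y z => by
      rw [hc, mul_smul, hcompat]
    intro y z
    rw [h, hsymm y, h, hsymm]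
  have hadjn : ∀ (n : ℕ) y z, B (c ^ n • y) z = B y (c ^ n • z) := by
    intro n
    induction n with
    | zero => simp
    | succ n ih =>
      intro y z
      rw [pow_succ, mul_smul, ih, hadj, ← mul_smul, mul_comm]
  have hψ : ∀ ψ : A →+* ℂ, ∀ d, ψ (d * σ d) = ((‖ψ d‖ ^ 2 : ℝ) : ℂ) := fun ψ d => by
    rw [map_mul, hσ, Complex.mul_conj, Complex.normSq_eq_norm_sq]
  have hu1 : B (a • x) (a • x) = B (c ^ 1 • x) x := by
    rw [hcompat, ← mul_smul, pow_one, hsymm, hc, mul_comm]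
  let b := Module.Free.chooseBasis ℤ A
  have hspec := aux_trace A b c (fun ψ => by
    rw [hc, hψ]; exact Complex.zero_le_real.2 (by positivity))
  have hnonneg : ∀ n, 0 ≤ B (c ^ n • x) x := by
    intro n
    have : ∀ y, 0 ≤ B (c • y) y := fun y => by
      rw [hc, mul_smul, hcompat]; exact hnn _
    obtain ⟨k, rfl | rfl⟩ := Nat.even_or_odd' n
    · rw [two_mul, pow_add, mul_smul, hadjn]; exact hnn _
    · rw [show 2 * k + 1 = k + (1 + k) by ring, pow_add, mul_smul, hadjn, pow_add, pow_one,
        mul_smul]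
      exact this _
  have htr0 : (0 : ℝ) ≤ (Algebra.trace ℤ A c : ℝ) := by
    have : Nontrivial L := ⟨x, 0, hx⟩
    have : Nontrivial A := Module.nontrivial A L
    have : Nonempty (Module.Free.ChooseBasisIndex ℤ A) := b.index_nonempty
    obtain ⟨μ, hμ⟩ := spectrum.nonempty_of_isAlgClosed_of_finiteDimensional ℂ
      ((Algebra.leftMulMatrix b c).map (Int.castRingHom ℂ))
    exact (norm_nonneg μ).trans (hspec μ hμ)
  have main := aux_real (fun n => (B (c ^ n • x) x : ℝ)) (Algebra.trace ℤ A c : ℝ)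
    (by simpa using hp) (fun n => by exact_mod_cast hnonneg n)
    (fun n => by
      have h := hcs (c ^ n • x)
      rw [hadjn n x (c ^ n • x), ← mul_smul, ← pow_add, ← two_mul,
        hsymm x (c ^ (2 * n) • x)] at h
      simp only [pow_zero, one_smul]
      exact_mod_cast h)
    (fun s hs => by
      let g : Matrix (Module.Free.ChooseBasisIndex ℤ A) (Module.Free.ChooseBasisIndex ℤ A) ℂ
          →ₗ[ℂ] ℂ :=
        { toFun := fun N => ∑ i, N.mulVec (fun j => ((b.repr 1 j : ℤ) : ℂ)) i * (B (b i • x) x : ℂ)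
          map_add' := fun N N' => by
            simp [Matrix.add_mulVec, add_mul, Finset.sum_add_distrib]
          map_smul' := fun r N => by
            simp [Matrix.smul_mulVec, Finset.mul_sum, mul_assoc] }
      have hg : ∀ d : A, g ((Algebra.leftMulMatrix b d).map (Int.castRingHom ℂ))
          = (B (d • x) x : ℂ) := by
        intro d
        have e1 : B (d • x) x = ∑ i, b.repr d i * B (b i • x) x := by
          let f : A →+ ℤ := AddMonoidHom.mk' (fun d => B (d • x) x)
            (fun d d' => by rw [add_smul, hadd1])
          have : f d = ∑ i, b.repr d i * f (b i) := by
            conv_lhs => rw [← b.sum_repr d]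
            simp only [map_sum, map_zsmul, smul_eq_mul]
          exact this
        have e2 : ∀ i, b.repr d i = ∑ j, Algebra.leftMulMatrix b d i j * b.repr 1 j := by
          intro i
          have := congrFun (Algebra.leftMulMatrix_mulVec_repr b d 1) i
          rw [mul_one] at this
          rw [← this]; rfl
        rw [e1]
        push_cast
        refine Finset.sum_congr rfl fun i _ => ?_
        rw [e2 i]
        simp [Matrix.mulVec, dotProduct]
      obtain ⟨C, hC⟩ := aux_matrix _ _ s htr0 hs hspec g
      refine ⟨C, hC.mono fun n hn => ?_⟩
      rw [← Matrix.map_pow, ← map_pow, hg, Complex.norm_intCast] at hn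
      exact (le_abs_self _).trans hn)
    htr0
  rw [hu1]
  simp only [pow_zero, one_smul] at main
  exact_mod_cast main
end
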